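/- arXiv:2410.20795 — 8 statements merged into one kernel-verified Lean document; each statement's English description precedes it below -/
import Mathlib

section
/- Let 0 < α < 1, λ ≥ 0, and let u : [0,∞) → ℂ be continuously differentiable with u(0) = 0 such that i ∂_t^α u(t) + λ u(t) = 0 for all t > 0. Then u(t) = 0 for all t ≥ 0 (uniqueness for the homogeneous fractional initial value problem). -/
/-- The Caputo fractional derivative of order `α`:
`∂_t^α u(t) = (1/Γ(1-α)) ∫_0^t (t-τ)^{-α} u'(τ) dτ`. -/
noncomputable def caputoDeriv (α : ℝ) (u : ℝ → ℂ) (t : ℝ) : ℂ :=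
  (Real.Gamma (1 - α) : ℂ)⁻¹ * ∫ τ in (0:ℝ)..t, (((t - τ) ^ (-α) : ℝ) : ℂ) * deriv u τ

open Set Filter Topology MeasureTheory

/-- If `w ≥ 0` vanishes and is differentiable at the right endpoint `t`, then integrating `w'` against
the Abel kernel `(t - s)^(-α)` gives at most the boundary term at `0`. -/
theorem integral_abel_kernel_mul_deriv_le {α t : ℝ} (h0 : 0 < α) (h1 : α < 1) (ht : 0 < t)
    {w w' : ℝ → ℝ} (hc : ContinuousOn w (Icc 0 t)) (hd : ∀ s ∈ Ioc 0 t, HasDerivAt w (w' s) s)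
    (hint : IntervalIntegrable (fun s => (t - s) ^ (-α) * w' s) volume 0 t)
    (hw : ∀ s ∈ Icc 0 t, 0 ≤ w s) (hwt : w t = 0) :
    ∫ s in (0:ℝ)..t, (t - s) ^ (-α) * w' s ≤ -(t ^ (-α) * w 0) := by
  have hcont : ContinuousOn (fun s => (t - s) ^ (-α) * w s) (Icc 0 t) := by
    intro s hs
    rcases hs.2.lt_or_eq with hst | rfl
    · refine ContinuousWithinAt.mul (ContinuousAt.continuousWithinAt ?_) (hc s hs)
      exact (continuousAt_const.sub continuousAt_id).rpow_const (Or.inl (sub_pos.2 hst).ne')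
    · obtain ⟨C, hC⟩ := (hd s ⟨ht, le_rfl⟩).isBigO_sub.bound
      have hlim : Tendsto (fun r : ℝ => C * (s - r) ^ (1 - α)) (𝓝[Icc 0 s] s) (𝓝 0) := by
        have : ContinuousAt (fun r : ℝ => C * (s - r) ^ (1 - α)) s :=
          continuousAt_const.mul ((continuousAt_const.sub continuousAt_id).rpow_const
            (Or.inr (by linarith)))
        have h := this.tendsto
        simp only [sub_self, Real.zero_rpow (by linarith : 1 - α ≠ 0), mul_zero] at h
        exact h.mono_left nhdsWithin_le_nhds
      simp only [ContinuousWithinAt, hwt, mul_zero]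
      refine squeeze_zero_norm' ?_ hlim
      filter_upwards [nhdsWithin_le_nhds hC, self_mem_nhdsWithin] with r hr hrs
      rcases hrs.2.lt_or_eq with hlt | rfl
      · have hp : 0 < s - r := sub_pos.2 hlt
        rw [hwt, sub_zero, norm_sub_rev, Real.norm_of_nonneg hp.le] at hr
        rw [norm_mul, Real.norm_of_nonneg (Real.rpow_nonneg hp.le _), sub_eq_add_neg 1 α,
          Real.rpow_add hp, Real.rpow_one]
        have := mul_le_mul_of_nonneg_left hr (Real.rpow_nonneg hp.le (-α))
        linarith
      · simp [hwt, Real.zero_rpow (by linarith : 1 - α ≠ 0)]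
  have key := intervalIntegral.integral_le_sub_of_hasDeriv_right_of_le ht.le hcont
    (g' := fun s => α * (t - s) ^ (-α - 1) * w s + (t - s) ^ (-α) * w' s)
    (φ := fun s => (t - s) ^ (-α) * w' s) ?_
    ((intervalIntegrable_iff_integrableOn_Icc_of_le ht.le).1 hint) ?_
  · simpa [hwt] using key
  · intro s hs
    have hp : 0 < t - s := sub_pos.2 hs.2
    have hk : HasDerivAt (fun s => (t - s) ^ (-α)) (α * (t - s) ^ (-α - 1)) s := by
      have := ((hasDerivAt_id' s).const_sub t).rpow_const (p := -α) (Or.inl hp.ne')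
      convert this using 1
      ring
    exact (hk.mul (hd s ⟨hs.1, hs.2.le⟩)).hasDerivWithinAt
  · intro s hs
    have hp : 0 < t - s := sub_pos.2 hs.2
    have := mul_nonneg (mul_nonneg h0.le (Real.rpow_nonneg hp.le (-α - 1)))
      (hw s ⟨hs.1.le, hs.2.le⟩)
    simpa using this

/-- The integrand of the Caputo derivative of a `C¹` function is integrable. -/
theorem intervalIntegrable_caputo_integrand {α t : ℝ} (h1 : α < 1) (ht : 0 < t) {u : ℝ → ℂ}
    (hu : ContDiffOn ℝ 1 u (Ici 0)) :
    IntervalIntegrable (fun s => (((t - s) ^ (-α) : ℝ) : ℂ) * deriv u s) volume 0 t := by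
  have hk : IntervalIntegrable (fun s : ℝ => (t - s) ^ (-α)) volume 0 t := by
    have := (intervalIntegral.intervalIntegrable_rpow' (a := 0) (b := t)
      (by linarith : -1 < -α)).comp_sub_left t
    simpa using this.symm
  have hv : ContinuousOn (derivWithin u (Ici 0)) (uIcc 0 t) := by
    rw [uIcc_of_le ht.le]
    exact (hu.continuousOn_derivWithin (uniqueDiffOn_Ici 0) le_rfl).mono Icc_subset_Ici_self
  have hk' : IntervalIntegrable (fun s : ℝ => (((t - s) ^ (-α) : ℝ) : ℂ)) volume 0 t :=
    ⟨hk.1.ofReal, hk.2.ofReal⟩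
  refine (hk'.mul_continuousOn hv).congr ?_
  intro s hs
  rw [uIoc_of_le ht.le] at hs
  simp only [derivWithin_of_mem_nhds (Ici_mem_nhds hs.1)]

/-- Let `t` maximise `‖u‖` on `[0, t]`. Then the Caputo derivative at `t` has an inner product with
`u t` at least that of the boundary term `t^(-α) u(t) / Γ(1-α)`. -/
theorem le_inner_caputoDeriv_of_isMaxOn {α t : ℝ} (h0 : 0 < α) (h1 : α < 1) (ht : 0 < t)
    {u : ℝ → ℂ} (hu : ContDiffOn ℝ 1 u (Ici 0)) (hu0 : u 0 = 0)
    (hmax : ∀ s ∈ Icc 0 t, ‖u s‖ ≤ ‖u t‖) :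
    (Real.Gamma (1 - α))⁻¹ * (t ^ (-α) * ‖u t‖ ^ 2) ≤ inner ℝ (u t) (caputoDeriv α u t) := by
  have hint := intervalIntegrable_caputo_integrand h1 ht hu
  have hL (s : ℝ) : innerSL ℝ (u t) ((((t - s) ^ (-α) : ℝ) : ℂ) * deriv u s)
      = (t - s) ^ (-α) * inner ℝ (u t) (deriv u s) := by
    rw [← Complex.real_smul, map_smul, innerSL_apply_apply, smul_eq_mul]
  have hcomm := (innerSL ℝ (u t)).intervalIntegral_comp_comm hint
  simp only [hL] at hcomm
  have hint' : IntervalIntegrable (fun s => (t - s) ^ (-α) * inner ℝ (u t) (deriv u s))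
      volume 0 t := by
    have : IntervalIntegrable (fun s => innerSL ℝ (u t)
        ((((t - s) ^ (-α) : ℝ) : ℂ) * deriv u s)) volume 0 t :=
      ⟨(innerSL ℝ (u t)).integrable_comp hint.1, (innerSL ℝ (u t)).integrable_comp hint.2⟩
    simpa only [hL] using this
  have key := integral_abel_kernel_mul_deriv_le h0 h1 ht
    (w := fun s => ‖u t‖ ^ 2 - inner ℝ (u t) (u s))
    (w' := fun s => -inner ℝ (u t) (deriv u s)) ?_ ?_ ?_ ?_ ?_
  · simp only [mul_neg, intervalIntegral.integral_neg, hcomm, hu0, inner_zero_right, sub_zero,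
      neg_le_neg_iff, innerSL_apply_apply] at key
    rw [caputoDeriv, ← Complex.ofReal_inv, ← Complex.real_smul, inner_smul_right]
    exact mul_le_mul_of_nonneg_left key (inv_nonneg.2 (Real.Gamma_pos_of_pos (by linarith)).le)
  · exact continuousOn_const.sub
      (continuousOn_const.inner (𝕜 := ℝ) (hu.continuousOn.mono Icc_subset_Ici_self))
  · intro s hs
    have hs' : HasDerivAt u (deriv u s) s :=
      ((hu.differentiableOn one_ne_zero).differentiableAt (Ici_mem_nhds hs.1)).hasDerivAt
    exact ((innerSL ℝ (u t)).hasFDerivAt.comp_hasDerivAt s hs').const_sub _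
  · simp only [mul_neg]
    exact hint'.neg
  · intro s hs
    have h2 := real_inner_le_norm (u t) (u s)
    have h3 := mul_le_mul_of_nonneg_left (hmax s hs) (norm_nonneg (u t))
    nlinarith
  · simp

/-- Uniqueness for the homogeneous fractional initial value problem: if `0 < α < 1`, `λ ≥ 0`,
`u` is continuously differentiable on `[0,∞)` with `u(0) = 0` and
`i ∂_t^α u(t) + λ u(t) = 0` for every `t > 0`, then `u ≡ 0` on `[0,∞)`. -/
theorem fracODE_homogeneous_uniqueness (α lam : ℝ) (h0 : 0 < α) (h1 : α < 1)
    (hlam : 0 ≤ lam) (u : ℝ → ℂ) (hu : ContDiffOn ℝ 1 u (Set.Ici 0)) (hu0 : u 0 = 0)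
    (heq : ∀ t : ℝ, 0 < t → Complex.I * caputoDeriv α u t + (lam : ℂ) * u t = 0) :
    ∀ t : ℝ, 0 ≤ t → u t = 0 := by
  intro T hT
  obtain ⟨t, htT, hmax⟩ := isCompact_Icc.exists_isMaxOn (nonempty_Icc.2 hT)
    (hu.continuousOn.mono (Icc_subset_Ici_self : Icc 0 T ⊆ Ici 0)).norm
  have hle : ‖u T‖ ≤ ‖u t‖ := hmax (right_mem_Icc.2 hT)
  suffices hut : u t = 0 by simpa [hut] using hle
  by_contra hne
  have ht : 0 < t := htT.1.lt_of_ne (by rintro rfl; exact hne hu0)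
  have key := le_inner_caputoDeriv_of_isMaxOn h0 h1 ht hu hu0
    fun s hs => hmax ⟨hs.1, hs.2.trans htT.2⟩
  have hD : caputoDeriv α u t = Complex.I * lam * u t := by
    linear_combination (-Complex.I) * heq t ht + (-caputoDeriv α u t) * -Complex.I_sq
  have hzero : inner ℝ (u t) (caputoDeriv α u t) = 0 := by
    rw [hD, Complex.inner]
    simp
    ring
  rw [hzero] at key
  have hG := Real.Gamma_pos_of_pos (by linarith : 0 < 1 - α)
  have hn : 0 < ‖u t‖ := norm_pos_iff.2 hne
  have : 0 < (Real.Gamma (1 - α))⁻¹ * (t ^ (-α) * ‖u t‖ ^ 2) := by positivity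
  linarith
end

section
/- Let 0 < α < 1, λ ≥ 0, and let f : [0,∞) → ℂ be twice continuously differentiable with compact support contained in (0,∞). Then the function u(t) := ∫_0^t K_λ(t−τ) f(τ) dτ satisfies the integration-by-parts identity λ u(t) = f(t) − ∫_0^t E_{α,1}(i λ (t−τ)^α) f′(τ) dτ for every t ≥ 0. -/
/-- The Mittag–Leffler function `E_{a,b}(z) = ∑_{k=0}^∞ z^k / Γ(ka + b)`. -/
noncomputable def mittagLeffler (a b : ℝ) (z : ℂ) : ℂ :=
  ∑' k : ℕ, z ^ k / (Real.Gamma (k * a + b) : ℂ)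

/-- The kernel `K_λ(t) = -i t^{α-1} E_{α,α}(i λ t^α)`. -/
noncomputable def fracKernel (α lam t : ℝ) : ℂ :=
  -Complex.I * ((t ^ (α - 1) : ℝ) : ℂ) *
    mittagLeffler α α (Complex.I * (lam : ℂ) * ((t ^ α : ℝ) : ℂ))

/-- The convolution solution `u(t) = ∫_0^t K_λ(t-τ) f(τ) dτ`. -/
noncomputable def convSol (α lam : ℝ) (f : ℝ → ℂ) (t : ℝ) : ℂ :=
  ∫ τ in (0:ℝ)..t, fracKernel α lam (t - τ) * f τ

theorem rpow_mul_exp_neg_le_Gamma {R x : ℝ} (hR : 0 < R) (hx : 1 ≤ x) :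
    R ^ (x - 1) * Real.exp (-R) ≤ Real.Gamma x := by
  have hint := Real.GammaIntegral_convergent (zero_lt_one.trans_le hx)
  rw [Real.Gamma_eq_integral (zero_lt_one.trans_le hx), ← integral_exp_neg_Ioi R,
    ← MeasureTheory.integral_const_mul]
  have hsub : Set.Ioi R ⊆ Set.Ioi (0 : ℝ) := Set.Ioi_subset_Ioi hR.le
  refine (MeasureTheory.setIntegral_mono_on ((integrableOn_exp_neg_Ioi R).const_mul _)
    (hint.mono_set hsub) measurableSet_Ioi fun y hy ↦ ?_).trans
    (MeasureTheory.setIntegral_mono_set hint ?_ hsub.eventuallyLE)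
  · rw [mul_comm]
    have hy' : R ≤ y := (Set.mem_Ioi.1 hy).le
    gcongr
  · filter_upwards [MeasureTheory.ae_restrict_mem measurableSet_Ioi] with y hy
    have : 0 < y := hy
    simp only [Pi.zero_apply]
    positivity

theorem summable_pow_div_Gamma {a : ℝ} (ha : 0 < a) (b : ℝ) {r : ℝ} (hr : 0 ≤ r) :
    Summable fun k : ℕ ↦ r ^ k / |Real.Gamma (k * a + b)| := by
  set R : ℝ := (2 * (r + 1)) ^ (1 / a) with hR
  have hRpos : 0 < R := by positivity
  have hRa : R ^ a = 2 * (r + 1) := by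
    rw [hR, ← Real.rpow_mul (by positivity), one_div_mul_cancel ha.ne', Real.rpow_one]
  refine Summable.of_norm_bounded_eventually_nat
    (summable_geometric_two.mul_right (Real.exp R / R ^ (b - 1))) ?_
  have hlarge : Filter.Tendsto (fun k : ℕ ↦ (k : ℝ) * a + b) Filter.atTop Filter.atTop :=
    Filter.tendsto_atTop_add_const_right _ _ (tendsto_natCast_atTop_atTop.atTop_mul_const ha)
  filter_upwards [hlarge.eventually_ge_atTop 1] with k hk
  have hpow : R ^ (k * a + b - 1) = (2 * (r + 1)) ^ k * R ^ (b - 1) := by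
    rw [add_sub_assoc, Real.rpow_add hRpos, mul_comm, mul_comm (k : ℝ), Real.rpow_mul hRpos.le,
      hRa, Real.rpow_natCast, mul_comm]
  have hG := rpow_mul_exp_neg_le_Gamma hRpos hk
  rw [hpow] at hG
  rw [Real.norm_of_nonneg (by positivity)]
  calc r ^ k / |Real.Gamma (k * a + b)|
      ≤ (r + 1) ^ k / ((2 * (r + 1)) ^ k * R ^ (b - 1) * Real.exp (-R)) := by
        gcongr
        · linarith
        · exact hG.trans (le_abs_self _)
    _ = (1 / 2) ^ k * (Real.exp R / R ^ (b - 1)) := by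
        rw [mul_pow, Real.exp_neg, one_div, inv_pow]
        field_simp

theorem norm_pow_div_Gamma_le {a b r : ℝ} (k : ℕ) {z : ℂ} (hz : ‖z‖ ≤ r) :
    ‖z ^ k / (Real.Gamma (k * a + b) : ℂ)‖ ≤ r ^ k / |Real.Gamma (k * a + b)| := by
  rw [norm_div, norm_pow, Complex.norm_real, Real.norm_eq_abs]
  gcongr

theorem differentiable_mittagLeffler {a : ℝ} (ha : 0 < a) (b : ℝ) :
    Differentiable ℂ (mittagLeffler a b) := by
  intro z
  have hd := Complex.differentiableOn_tsum_of_summable_norm (U := Metric.ball 0 (‖z‖ + 1))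
    (F := fun (k : ℕ) (w : ℂ) ↦ w ^ k / (Real.Gamma (k * a + b) : ℂ))
    (summable_pow_div_Gamma ha b (by positivity : 0 ≤ ‖z‖ + 1))
    (fun k ↦ by fun_prop) Metric.isOpen_ball
    (fun k w hw ↦ norm_pow_div_Gamma_le k (mem_ball_zero_iff.1 hw).le)
  exact hd.differentiableAt (Metric.isOpen_ball.mem_nhds (by simp))

theorem hasDerivAt_mittagLeffler_one {a : ℝ} (ha : 0 < a) (z : ℂ) :
    HasDerivAt (mittagLeffler a 1) (mittagLeffler a a z / a) z := by
  have hs := Complex.hasSum_deriv_of_summable_norm (U := Metric.ball 0 (‖z‖ + 1)) (z := z)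
    (F := fun (k : ℕ) (w : ℂ) ↦ w ^ k / (Real.Gamma (k * a + 1) : ℂ))
    (summable_pow_div_Gamma ha 1 (by positivity : 0 ≤ ‖z‖ + 1))
    (fun k ↦ by fun_prop) Metric.isOpen_ball
    (fun k w hw ↦ norm_pow_div_Gamma_le k (mem_ball_zero_iff.1 hw).le) (by simp)
  have hd := (differentiable_mittagLeffler ha 1 z).hasDerivAt
  convert! hd using 1
  change _ = deriv (fun w ↦ ∑' k : ℕ, w ^ k / (Real.Gamma (k * a + 1) : ℂ)) z
  rw [← hs.tsum_eq, hs.summable.tsum_eq_zero_add, mittagLeffler, ← tsum_div_const]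
  simp only [pow_zero, deriv_const, zero_add, deriv_div_const]
  refine tsum_congr fun k ↦ ?_
  have hpos : 0 < (k : ℝ) * a + a := by positivity
  have hk : ((k + 1 : ℕ) : ℝ) * a + 1 = (k * a + a) + 1 := by push_cast; ring
  rw [hk, Real.Gamma_add_one hpos.ne', deriv_pow_field]
  have hG : (Real.Gamma (k * a + a) : ℂ) ≠ 0 := by exact_mod_cast (Real.Gamma_pos_of_pos hpos).ne'
  have ha' : (a : ℂ) ≠ 0 := by exact_mod_cast ha.ne'
  have hk1 : (k : ℂ) + 1 ≠ 0 := by exact_mod_cast k.succ_ne_zero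
  have hfac : (k : ℂ) * a + a = (k + 1) * a := by ring
  push_cast
  rw [hfac]
  field_simp

theorem mittagLeffler_zero {a : ℝ} (b : ℝ) :
    mittagLeffler a b 0 = 1 / (Real.Gamma b : ℂ) := by
  rw [mittagLeffler, tsum_eq_single 0 fun k hk ↦ by simp [hk]]
  simp

theorem hasDerivAt_mittagLeffler_rpow {α : ℝ} (h0 : 0 < α) (lam : ℝ) {s : ℝ} (hs : 0 < s) :
    HasDerivAt (fun s : ℝ ↦ mittagLeffler α 1 (Complex.I * (lam : ℂ) * ((s ^ α : ℝ) : ℂ)))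
      (-(lam : ℂ) * fracKernel α lam s) s := by
  have hp : HasDerivAt (fun s : ℝ ↦ Complex.I * (lam : ℂ) * ((s ^ α : ℝ) : ℂ))
      (Complex.I * (lam : ℂ) * ((α * s ^ (α - 1) : ℝ) : ℂ)) s :=
    (Real.hasDerivAt_rpow_const (Or.inl hs.ne')).ofReal_comp.const_mul _
  have hα : (α : ℂ) ≠ 0 := by exact_mod_cast h0.ne'
  convert! (hasDerivAt_mittagLeffler_one h0 _).comp s hp using 1
  rw [fracKernel]
  push_cast
  field_simp

theorem continuous_mittagLeffler_rpow {α : ℝ} (h0 : 0 < α) (b lam : ℝ) :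
    Continuous fun s : ℝ ↦ mittagLeffler α b (Complex.I * (lam : ℂ) * ((s ^ α : ℝ) : ℂ)) :=
  (differentiable_mittagLeffler h0 b).continuous.comp
    (continuous_const.mul (Complex.continuous_ofReal.comp (Real.continuous_rpow_const h0.le)))

theorem intervalIntegrable_fracKernel {α : ℝ} (h0 : 0 < α) (lam a b : ℝ) :
    IntervalIntegrable (fracKernel α lam) MeasureTheory.volume a b := by
  have hr : IntervalIntegrable (fun s : ℝ ↦ s ^ (α - 1)) MeasureTheory.volume a b :=
    intervalIntegral.intervalIntegrable_rpow' (by linarith)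
  have hc : IntervalIntegrable (fun s : ℝ ↦ ((s ^ (α - 1) : ℝ) : ℂ)) MeasureTheory.volume a b :=
    ⟨hr.1.ofReal, hr.2.ofReal⟩
  exact (hc.const_mul (-Complex.I)).mul_continuousOn
    (continuous_mittagLeffler_rpow h0 α lam).continuousOn

/-- Integration by parts identity: for `0 < α < 1`, `λ ≥ 0` and `f` twice continuously
differentiable with compact support in `(0,∞)`, the function
`u(t) = ∫_0^t K_λ(t-τ) f(τ) dτ` satisfies
`λ u(t) = f(t) - ∫_0^t E_{α,1}(iλ(t-τ)^α) f'(τ) dτ` for every `t ≥ 0`. -/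
theorem convSol_integration_by_parts (α lam : ℝ) (h0 : 0 < α) (h1 : α < 1) (hlam : 0 ≤ lam)
    (f : ℝ → ℂ) (hf : ContDiff ℝ 2 f) (hfc : HasCompactSupport f)
    (hfs : tsupport f ⊆ Set.Ioi 0) :
    ∀ t : ℝ, 0 ≤ t →
      (lam : ℂ) * convSol α lam f t =
        f t - ∫ τ in (0:ℝ)..t,
          mittagLeffler α 1 (Complex.I * (lam : ℂ) * (((t - τ) ^ α : ℝ) : ℂ)) * deriv f τ := by
  intro t ht
  have hf0 : f 0 = 0 := image_eq_zero_of_notMem_tsupport fun h ↦ lt_irrefl (0 : ℝ) (hfs h)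
  have hparts := intervalIntegral.integral_mul_deriv_eq_deriv_mul_of_hasDerivAt
    (a := 0) (b := t) (v := f) (v' := deriv f)
    (u := fun τ ↦ mittagLeffler α 1 (Complex.I * (lam : ℂ) * (((t - τ) ^ α : ℝ) : ℂ)))
    (u' := fun τ ↦ (lam : ℂ) * fracKernel α lam (t - τ))
    ((continuous_mittagLeffler_rpow h0 1 lam).comp
      (continuous_const.sub continuous_id)).continuousOn
    hf.continuous.continuousOn
    (fun τ hτ ↦ by
      rw [max_eq_right ht] at hτ
      convert! (hasDerivAt_mittagLeffler_rpow h0 lam (sub_pos.2 hτ.2)).scomp τ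
        ((hasDerivAt_id τ).const_sub t) using 1
      simp)
    (fun τ _ ↦ (hf.differentiable (by norm_num) τ).hasDerivAt)
    (by simpa using
      ((intervalIntegrable_fracKernel h0 lam t 0).comp_sub_left t).const_mul (lam : ℂ))
    ((hf.continuous_deriv (by norm_num)).intervalIntegrable _ _)
  simp only [mul_assoc, intervalIntegral.integral_const_mul] at hparts
  simp only [mul_assoc, convSol]
  rw [hparts]
  simp [hf0, Real.zero_rpow h0.ne', mittagLeffler_zero]
end

section
/- Let 0 < α < 1, λ ≥ 0, and let f : [0,∞) → ℂ be twice continuously differentiable with compact support contained in (0,∞). Then for every s ∈ ℂ with Re s > 0, the function u(t) := ∫_0^t K_λ(t−τ) f(τ) dτ satisfies ∫_0^∞ e^{−st} u(t) dt = (1 / (i s^α + λ)) ∫_0^∞ e^{−st} f(t) dt, where s^α denotes the principal branch and i s^α + λ ≠ 0. -/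
section

open MeasureTheory Set Filter Topology ContinuousLinearMap
open scoped Convolution

/-- The Riemann–Liouville kernel `g_b(t) = t^{b-1} / Γ(b)` on `(0, ∞)`, extended by zero. -/
noncomputable def rlKernel (b t : ℝ) : ℝ :=
  (Ioi (0 : ℝ)).indicator (fun t => t ^ (b - 1) / Real.Gamma b) t

lemma rlKernel_of_pos {b t : ℝ} (ht : 0 < t) : rlKernel b t = t ^ (b - 1) / Real.Gamma b :=
  indicator_of_mem (mem_Ioi.2 ht) _

lemma rlKernel_of_nonpos {b t : ℝ} (ht : t ≤ 0) : rlKernel b t = 0 :=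
  indicator_of_notMem (by simpa using ht) _

lemma rlKernel_pos {b t : ℝ} (hb : 0 < b) (ht : 0 < t) : 0 < rlKernel b t := by
  rw [rlKernel_of_pos ht]
  have := Real.Gamma_pos_of_pos hb
  positivity

lemma rlKernel_nonneg {b : ℝ} (hb : 0 < b) (t : ℝ) : 0 ≤ rlKernel b t := by
  rcases le_or_gt t 0 with ht | ht
  · rw [rlKernel_of_nonpos ht]
  · exact (rlKernel_pos hb ht).le

lemma rlKernel_one {t : ℝ} (ht : 0 < t) : rlKernel 1 t = 1 := by
  simp [rlKernel_of_pos ht]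

lemma rlKernel_anti {b x y : ℝ} (hb : 0 < b) (hb1 : b < 1) (hx : 0 < x) (hxy : x ≤ y) :
    rlKernel b y ≤ rlKernel b x := by
  rw [rlKernel_of_pos hx, rlKernel_of_pos (hx.trans_le hxy)]
  have := Real.Gamma_pos_of_pos hb
  gcongr ?_ / _
  exact Real.rpow_le_rpow_of_nonpos hx hxy (by linarith)

lemma measurable_rlKernel (b : ℝ) : Measurable (rlKernel b) :=
  Measurable.indicator (by fun_prop) measurableSet_Ioi

lemma locallyIntegrable_rlKernel {b : ℝ} (hb : 0 < b) : LocallyIntegrable (rlKernel b) := by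
  refine LocallyIntegrable.indicator (f := fun t => t ^ (b - 1) / Real.Gamma b) ?_ measurableSet_Ioi
  rw [locallyIntegrable_iff]
  intro K hK
  obtain ⟨r, hr⟩ := hK.isBounded.subset_closedBall 0
  rw [Real.closedBall_eq_Icc] at hr
  refine IntegrableOn.mono_set ?_ hr
  have : IntervalIntegrable (fun x : ℝ => x ^ (b - 1)) volume (0 - r) (0 + r) :=
    intervalIntegral.intervalIntegrable_rpow' (by linarith)
  rcases le_or_gt (0 - r) (0 + r) with h | h
  · exact ((intervalIntegrable_iff_integrableOn_Icc_of_le h).1 this).div_const _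
  · rw [Icc_eq_empty h.not_ge]
    exact integrableOn_empty

/-- The semigroup property of the Riemann–Liouville kernels. -/
lemma integral_rlKernel_mul {a b : ℝ} (ha : 0 < a) (hb : 0 < b) {t : ℝ} (ht : 0 < t) :
    ∫ x, rlKernel a x * rlKernel b (t - x) = rlKernel (a + b) t := by
  have hΓa := Real.Gamma_pos_of_pos ha
  have hΓb := Real.Gamma_pos_of_pos hb
  have hΓ := Real.Gamma_pos_of_pos (add_pos ha hb)
  have h1 : ∫ x, rlKernel a x * rlKernel b (t - x) =
      ∫ x in (0:ℝ)..t, rlKernel a x * rlKernel b (t - x) := by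
    rw [intervalIntegral.integral_of_le ht.le, setIntegral_eq_integral_of_forall_compl_eq_zero]
    intro x hx
    by_cases h : 0 < x
    · rw [rlKernel_of_nonpos (b := b), mul_zero]
      have : t < x := by_contra fun h' => hx ⟨h, not_lt.1 h'⟩
      linarith
    · rw [rlKernel_of_nonpos (not_lt.1 h), zero_mul]
  rw [h1, rlKernel_of_pos ht]
  have h2 := Complex.betaIntegral_scaled a b ht
  have h3 := Complex.Gamma_mul_Gamma_eq_betaIntegral (s := a) (t := b) (by simpa) (by simpa)
  have h4 : ∫ x in (0:ℝ)..t, (x : ℂ) ^ ((a : ℂ) - 1) * ((t : ℂ) - x) ^ ((b : ℂ) - 1) =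
      ((∫ x in (0:ℝ)..t, x ^ (a - 1) * (t - x) ^ (b - 1) : ℝ) : ℂ) := by
    rw [← intervalIntegral.integral_ofReal]
    refine intervalIntegral.integral_congr fun x hx => ?_
    rw [uIcc_of_le ht.le] at hx
    have h5 : (0 : ℝ) ≤ t - x := by linarith [hx.2]
    push_cast [Complex.ofReal_cpow hx.1, Complex.ofReal_cpow h5]
    rfl
  have h6 : ∫ x in (0:ℝ)..t, rlKernel a x * rlKernel b (t - x) =
      (∫ x in (0:ℝ)..t, x ^ (a - 1) * (t - x) ^ (b - 1)) / (Real.Gamma a * Real.Gamma b) := by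
    rw [← intervalIntegral.integral_div, intervalIntegral.integral_of_le ht.le,
      intervalIntegral.integral_of_le ht.le, integral_Ioc_eq_integral_Ioo,
      integral_Ioc_eq_integral_Ioo]
    refine setIntegral_congr_fun measurableSet_Ioo fun x hx => ?_
    rw [rlKernel_of_pos hx.1, rlKernel_of_pos (sub_pos.2 hx.2)]
    field_simp
  rw [h6]
  rw [h4] at h2
  rw [← Complex.ofReal_add, Complex.Gamma_ofReal, Complex.Gamma_ofReal, Complex.Gamma_ofReal] at h3
  have h7 : ((a : ℂ) + b - 1) = ((a + b - 1 : ℝ) : ℂ) := by push_cast; ring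
  rw [h7, ← Complex.ofReal_cpow ht.le] at h2
  have hΓ' : (Real.Gamma (a + b) : ℂ) ≠ 0 := by exact_mod_cast hΓ.ne'
  have h8 : ((∫ x in (0:ℝ)..t, x ^ (a - 1) * (t - x) ^ (b - 1) : ℝ) : ℂ) * (Real.Gamma (a + b) : ℂ) =
      ((t ^ (a + b - 1) : ℝ) : ℂ) * ((Real.Gamma a : ℂ) * (Real.Gamma b : ℂ)) := by
    rw [h2, h3]; ring
  have h9 : (∫ x in (0:ℝ)..t, x ^ (a - 1) * (t - x) ^ (b - 1)) * Real.Gamma (a + b) =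
      t ^ (a + b - 1) * (Real.Gamma a * Real.Gamma b) := by exact_mod_cast h8
  field_simp
  linarith

lemma integrable_rlKernel_mul {a b : ℝ} (ha : 0 < a) (hb : 0 < b) {t : ℝ} (ht : 0 < t) :
    Integrable fun x => rlKernel a x * rlKernel b (t - x) := by
  refine Integrable.of_integral_ne_zero ?_
  rw [integral_rlKernel_mul ha hb ht]
  exact (rlKernel_pos (add_pos ha hb) ht).ne'

lemma Real.exp_mul_rpow_le_Gamma {R y : ℝ} (hR : 0 < R) (hy : 1 ≤ y) :
    Real.exp (-(R + 1)) * R ^ (y - 1) ≤ Real.Gamma y := by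
  have hint := Real.GammaIntegral_convergent (s := y) (by linarith)
  rw [Real.Gamma_eq_integral (by linarith)]
  have hsub : Icc R (R + 1) ⊆ Ioi 0 := fun x hx => hR.trans_le hx.1
  calc Real.exp (-(R + 1)) * R ^ (y - 1)
      = ∫ x in Icc R (R + 1), Real.exp (-(R + 1)) * R ^ (y - 1) := by simp
    _ ≤ ∫ x in Icc R (R + 1), Real.exp (-x) * x ^ (y - 1) := by
        refine setIntegral_mono_on continuous_const.integrableOn_Icc (hint.mono_set hsub)
          measurableSet_Icc fun x hx => ?_
        have h1 : 0 ≤ y - 1 := by linarith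
        have h2 := hx.1
        have h3 := hx.2
        gcongr
    _ ≤ _ := by
        refine setIntegral_mono_set hint ?_ hsub.eventuallyLE
        filter_upwards [ae_restrict_mem measurableSet_Ioi] with x hx
        have : 0 < x := hx
        positivity

lemma summable_mittagLeffler {a b : ℝ} (ha : 0 < a) (hb : 0 < b) {x : ℝ} (hx : 0 ≤ x) :
    Summable fun k : ℕ => x ^ k / Real.Gamma (k * a + b) := by
  obtain ⟨R, hR, hRx⟩ : ∃ R : ℝ, 0 < R ∧ 2 * x ≤ R ^ a := by
    have := (tendsto_rpow_atTop ha).eventually_ge_atTop (2 * x)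
    exact ((eventually_gt_atTop 0).and this).exists
  have hgeo : Summable fun k : ℕ => Real.exp (R + 1) * R ^ (1 - b) * (1 / 2 : ℝ) ^ k :=
    summable_geometric_two.mul_left _
  refine hgeo.of_norm_bounded_eventually_nat ?_
  have hlarge : ∀ᶠ k : ℕ in atTop, 1 ≤ (k : ℝ) * a := by
    have : Tendsto (fun k : ℕ => (k : ℝ) * a) atTop atTop :=
      tendsto_natCast_atTop_atTop.atTop_mul_const ha
    exact this.eventually_ge_atTop 1
  filter_upwards [hlarge] with k hk
  have hpos : 0 < (k : ℝ) * a + b := by linarith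
  have hΓ := Real.Gamma_pos_of_pos hpos
  rw [Real.norm_of_nonneg (by positivity), div_le_iff₀ hΓ]
  have h1 := Real.exp_mul_rpow_le_Gamma hR (y := k * a + b) (by linarith)
  have h2 : R ^ ((k : ℝ) * a + b - 1) = (R ^ a) ^ k * R ^ (b - 1) := by
    rw [← Real.rpow_natCast, ← Real.rpow_mul hR.le, ← Real.rpow_add hR]
    ring_nf
  have h3 : R ^ (1 - b) * R ^ (b - 1) = 1 := by
    rw [← Real.rpow_add hR]; simp
  have h4 : Real.exp (R + 1) * Real.exp (-(R + 1)) = 1 := by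
    rw [← Real.exp_add]; simp
  calc x ^ k ≤ (R ^ a / 2) ^ k := by gcongr; linarith
    _ = (Real.exp (R + 1) * Real.exp (-(R + 1))) * (R ^ (1 - b) * R ^ (b - 1)) *
        ((R ^ a) ^ k * (1 / 2) ^ k) := by rw [h3, h4, ← mul_pow]; ring
    _ = Real.exp (R + 1) * R ^ (1 - b) * (1 / 2) ^ k *
        (Real.exp (-(R + 1)) * R ^ ((k : ℝ) * a + b - 1)) := by rw [h2]; ring
    _ ≤ _ := by gcongr

/-- The kernel `K_λ`, extended by zero to `(-∞, 0]`. -/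
noncomputable def fracKernelExt (α lam t : ℝ) : ℂ :=
  (Ioi (0 : ℝ)).indicator (fracKernel α lam) t

lemma fracKernelExt_of_nonpos {α lam t : ℝ} (ht : t ≤ 0) : fracKernelExt α lam t = 0 :=
  indicator_of_notMem (by simpa using ht) _

lemma rlKernel_natCast_succ_mul {α t : ℝ} (ht : 0 < t) (b : ℝ) (j : ℕ) :
    rlKernel (j * α + b) t = t ^ (b - 1) * ((t ^ α) ^ j / Real.Gamma (j * α + b)) := by
  rw [rlKernel_of_pos ht, ← Real.rpow_natCast, ← Real.rpow_mul ht.le, ← mul_div_assoc,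
    ← Real.rpow_add ht]
  ring_nf

lemma summable_rlKernel {α lam b : ℝ} (h0 : 0 < α) (hlam : 0 ≤ lam) (hb : 0 < b) (t : ℝ) :
    Summable fun j : ℕ => lam ^ j * rlKernel (j * α + b) t := by
  rcases le_or_gt t 0 with ht | ht
  · simp [rlKernel_of_nonpos ht]
  · have h := (summable_mittagLeffler h0 hb (x := lam * t ^ α) (by positivity)).mul_left
      (t ^ (b - 1))
    refine h.congr fun j => ?_
    rw [rlKernel_natCast_succ_mul ht, mul_pow]
    ring

lemma norm_I_mul_pow {lam : ℝ} (hlam : 0 ≤ lam) (j : ℕ) :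
    ‖-Complex.I * (Complex.I * (lam : ℂ)) ^ j‖ = lam ^ j := by
  simp [abs_of_nonneg hlam]

lemma hasSum_fracKernelExt {α lam : ℝ} (h0 : 0 < α) (hlam : 0 ≤ lam) (t : ℝ) :
    HasSum (fun j : ℕ => -Complex.I * (Complex.I * (lam : ℂ)) ^ j *
      (rlKernel (j * α + α) t : ℂ)) (fracKernelExt α lam t) := by
  have hs : Summable (fun j : ℕ => -Complex.I * (Complex.I * (lam : ℂ)) ^ j *
      (rlKernel (j * α + α) t : ℂ)) := by
    refine (summable_rlKernel h0 hlam h0 t).of_norm_bounded fun j => ?_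
    have hp : 0 < (j : ℝ) * α + α := by positivity
    rw [norm_mul, norm_I_mul_pow hlam, Complex.norm_real,
      Real.norm_of_nonneg (rlKernel_nonneg hp t)]
  convert hs.hasSum using 1
  rcases le_or_gt t 0 with ht | ht
  · simp [fracKernelExt_of_nonpos ht, rlKernel_of_nonpos ht]
  · rw [fracKernelExt, indicator_of_mem (mem_Ioi.2 ht), fracKernel, mittagLeffler, ← tsum_mul_left]
    refine tsum_congr fun j => ?_
    rw [rlKernel_natCast_succ_mul ht]
    push_cast
    ring

lemma aestronglyMeasurable_fracKernelExt {α lam : ℝ} (h0 : 0 < α) (hlam : 0 ≤ lam) :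
    AEStronglyMeasurable (fracKernelExt α lam) := by
  refine aestronglyMeasurable_of_tendsto_ae atTop
    (f := fun n t => ∑ j ∈ Finset.range n, -Complex.I * (Complex.I * (lam : ℂ)) ^ j *
      (rlKernel (j * α + α) t : ℂ)) (fun n => ?_)
    (ae_of_all _ fun t => (hasSum_fracKernelExt h0 hlam t).tendsto_sum_nat)
  refine Measurable.aestronglyMeasurable ?_
  exact Finset.measurable_fun_sum _ fun j _ =>
    (Complex.measurable_ofReal.comp (measurable_rlKernel _)).const_mul _

lemma exists_norm_fracKernelExt_le {α lam : ℝ} (h0 : 0 < α) (hlam : 0 ≤ lam) (T : ℝ) :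
    ∃ C, ∀ t ≤ T, ‖fracKernelExt α lam t‖ ≤ C * rlKernel α t := by
  have hΓ := Real.Gamma_pos_of_pos h0
  refine ⟨Real.Gamma α * ∑' j : ℕ, (lam * (max T 0) ^ α) ^ j / Real.Gamma (j * α + α),
    fun t htT => ?_⟩
  rcases le_or_gt t 0 with ht | ht
  · simp [fracKernelExt_of_nonpos ht, rlKernel_of_nonpos ht]
  have hs := summable_mittagLeffler h0 h0 (x := lam * (max T 0) ^ α) (by positivity)
  have h1 : HasSum (fun j : ℕ => t ^ (α - 1) *
      ((lam * (max T 0) ^ α) ^ j / Real.Gamma (j * α + α))) _ := hs.hasSum.mul_left _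
  rw [← (hasSum_fracKernelExt h0 hlam t).tsum_eq]
  refine (tsum_of_norm_bounded h1 fun j => ?_).trans_eq ?_
  · have hp : 0 < (j : ℝ) * α + α := by positivity
    have hΓj := Real.Gamma_pos_of_pos hp
    rw [norm_mul, norm_I_mul_pow hlam, Complex.norm_real,
      Real.norm_of_nonneg (rlKernel_nonneg hp t), rlKernel_natCast_succ_mul ht]
    have : t ≤ max T 0 := htT.trans (le_max_left _ _)
    calc lam ^ j * (t ^ (α - 1) * ((t ^ α) ^ j / Real.Gamma (j * α + α)))
        = t ^ (α - 1) * ((lam * t ^ α) ^ j / Real.Gamma (j * α + α)) := by rw [mul_pow]; ring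
      _ ≤ _ := by gcongr
  · rw [rlKernel_of_pos ht]
    field_simp

lemma locallyIntegrable_fracKernelExt {α lam : ℝ} (h0 : 0 < α) (hlam : 0 ≤ lam) :
    LocallyIntegrable (fracKernelExt α lam) := by
  rw [locallyIntegrable_iff]
  intro K hK
  obtain ⟨T, hT⟩ := hK.bddAbove
  obtain ⟨C, hC⟩ := exists_norm_fracKernelExt_le h0 hlam T
  refine Integrable.mono' (((locallyIntegrable_rlKernel h0).integrableOn_isCompact hK).const_mul C)
    (aestronglyMeasurable_fracKernelExt h0 hlam).restrict ?_
  filter_upwards [ae_restrict_mem hK.measurableSet] with t ht using hC t (hT ht)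

lemma rlKernel_convolutionExistsAt_fracKernelExt {α lam b : ℝ} (h0 : 0 < α) (hlam : 0 ≤ lam)
    (hb : 0 < b) (t : ℝ) :
    ConvolutionExistsAt (rlKernel b) (fracKernelExt α lam) t (lsmul ℝ ℝ) volume := by
  rcases le_or_gt t 0 with ht | ht
  · refine (integrable_zero ℝ ℂ volume).congr (ae_of_all _ fun x => ?_)
    rcases le_or_gt x 0 with hx | hx
    · simp [rlKernel_of_nonpos hx]
    · simp [fracKernelExt_of_nonpos (show t - x ≤ 0 by linarith)]
  obtain ⟨C, hC⟩ := exists_norm_fracKernelExt_le h0 hlam t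
  refine Integrable.mono' ((integrable_rlKernel_mul hb h0 ht).const_mul C) ?_ ?_
  · exact ((measurable_rlKernel b).aestronglyMeasurable).convolution_integrand_snd _
      (aestronglyMeasurable_fracKernelExt h0 hlam) t
  · refine ae_of_all _ fun x => ?_
    rcases le_or_gt x 0 with hx | hx
    · simp [rlKernel_of_nonpos hx]
    · have := hC (t - x) (by linarith)
      have h2 := rlKernel_nonneg hb x
      rw [lsmul_apply, norm_smul, Real.norm_of_nonneg h2]
      calc _ ≤ rlKernel b x * (C * rlKernel α (t - x)) := by gcongr
        _ = _ := by ring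

/-- Convolving the kernel `K_λ` with `g_b` shifts the exponents of its series by `b`. -/
lemma hasSum_rlKernel_convolution_fracKernelExt {α lam b : ℝ} (h0 : 0 < α) (hlam : 0 ≤ lam)
    (hb : 0 < b) (t : ℝ) :
    HasSum (fun j : ℕ => -Complex.I * (Complex.I * (lam : ℂ)) ^ j *
      (rlKernel (j * α + (α + b)) t : ℂ))
      ((rlKernel b ⋆[lsmul ℝ ℝ] fracKernelExt α lam) t) := by
  rw [convolution_def]
  rcases le_or_gt t 0 with ht | ht
  · convert hasSum_zero (α := ℂ) (β := ℕ) using 1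
    · simp [rlKernel_of_nonpos ht]
    · refine integral_eq_zero_of_ae (ae_of_all _ fun x => ?_)
      rcases le_or_gt x 0 with hx | hx
      · simp [rlKernel_of_nonpos hx]
      · simp [fracKernelExt_of_nonpos (show t - x ≤ 0 by linarith)]
  have hp (j : ℕ) : 0 < (j : ℝ) * α + α := by positivity
  have hexp (j : ℕ) : b + (j * α + α) = j * α + (α + b) := by ring
  set F : ℕ → ℝ → ℂ := fun j x => -Complex.I * (Complex.I * (lam : ℂ)) ^ j *
    ((rlKernel b x * rlKernel (j * α + α) (t - x) : ℝ) : ℂ) with hF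
  have hFi (j : ℕ) : Integrable (F j) :=
    (integrable_rlKernel_mul hb (hp j) ht).ofReal.const_mul _
  have hFn (j : ℕ) : ∫ x, ‖F j x‖ = lam ^ j * rlKernel (j * α + (α + b)) t := by
    rw [← hexp, ← integral_rlKernel_mul hb (hp j) ht, ← integral_const_mul]
    refine integral_congr_ae (ae_of_all _ fun x => ?_)
    simp only [hF]
    rw [norm_mul, norm_I_mul_pow hlam, Complex.norm_real, Real.norm_of_nonneg
      (mul_nonneg (rlKernel_nonneg hb _) (rlKernel_nonneg (hp j) _))]
  have hS : Summable fun j => ∫ x, ‖F j x‖ := by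
    simp_rw [hFn]
    exact summable_rlKernel h0 hlam (by positivity) t
  have hterm (j : ℕ) : -Complex.I * (Complex.I * (lam : ℂ)) ^ j *
      (rlKernel (j * α + (α + b)) t : ℂ) = ∫ x, F j x := by
    rw [← hexp, ← integral_rlKernel_mul hb (hp j) ht]
    simp only [hF]
    rw [integral_const_mul, integral_complex_ofReal]
  have hval : ∫ x, lsmul ℝ ℝ (rlKernel b x) (fracKernelExt α lam (t - x)) =
      ∫ x, ∑' j, F j x := by
    refine integral_congr_ae (ae_of_all _ fun x => ?_)
    have h := (hasSum_fracKernelExt h0 hlam (t - x)).mul_left (rlKernel b x : ℂ)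
    simp only [lsmul_apply, Complex.real_smul, hF]
    rw [← h.tsum_eq]
    refine tsum_congr fun j => ?_
    push_cast
    ring
  rw [funext hterm, hval]
  exact hasSum_integral_of_summable_integral_norm hFi hS

lemma rlKernel_convolution_fracKernelExt {α lam : ℝ} (h0 : 0 < α) (h1 : α < 1) (hlam : 0 ≤ lam)
    (t : ℝ) :
    (rlKernel (1 - α) ⋆[lsmul ℝ ℝ] fracKernelExt α lam) t =
      -Complex.I * rlKernel 1 t +
        Complex.I * lam * (rlKernel 1 ⋆[lsmul ℝ ℝ] fracKernelExt α lam) t := by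
  have hA := hasSum_rlKernel_convolution_fracKernelExt h0 hlam (sub_pos.2 h1) t
  have hB := (hasSum_rlKernel_convolution_fracKernelExt h0 hlam one_pos t).mul_left
    (Complex.I * (lam : ℂ))
  rw [← hA.tsum_eq, ← hB.tsum_eq, hA.summable.tsum_eq_zero_add]
  congr 1
  · simp
  · refine tsum_congr fun j => ?_
    have : ((j + 1 : ℕ) : ℝ) * α + (α + (1 - α)) = j * α + (α + 1) := by push_cast; ring
    rw [this]
    ring

/-- Convolution of a locally integrable function on `(0, ∞)` with a continuous function
vanishing on `(-∞, 0]` always exists. -/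
lemma convolutionExistsAt_of_eq_zero_of_nonpos {E E' F : Type*} [NormedAddCommGroup E]
    [NormedAddCommGroup E'] [NormedAddCommGroup F] [NormedSpace ℝ E] [NormedSpace ℝ E']
    [NormedSpace ℝ F] (L : E →L[ℝ] E' →L[ℝ] F) {g : ℝ → E} {v : ℝ → E'}
    (hg : LocallyIntegrable g) (hg0 : ∀ t ≤ 0, g t = 0) (hv : Continuous v)
    (hv0 : ∀ t ≤ 0, v t = 0) (x : ℝ) : ConvolutionExistsAt g v x L volume := by
  refine HasCompactSupport.convolutionExistsAt L ?_ hg hv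
  refine HasCompactSupport.intro (isCompact_Icc (a := (0 : ℝ)) (b := x)) fun t ht => ?_
  rcases le_or_gt t 0 with h | h
  · simp [hg0 t h]
  · have : x < t := by_contra fun h' => ht ⟨h.le, not_lt.1 h'⟩
    simp [hv0 (x - t) (by linarith)]

lemma convolution_eq_zero_of_nonpos {E E' F : Type*} [NormedAddCommGroup E]
    [NormedAddCommGroup E'] [NormedAddCommGroup F] [NormedSpace ℝ E] [NormedSpace ℝ E']
    [NormedSpace ℝ F] (L : E →L[ℝ] E' →L[ℝ] F) {g : ℝ → E} {v : ℝ → E'}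
    (hg0 : ∀ t ≤ 0, g t = 0) (hv0 : ∀ t ≤ 0, v t = 0) {x : ℝ} (hx : x ≤ 0) :
    (g ⋆[L] v) x = 0 := by
  rw [convolution_def]
  refine integral_eq_zero_of_ae (ae_of_all _ fun t => ?_)
  rcases le_or_gt t 0 with h | h
  · simp [hg0 t h]
  · simp [hv0 (x - t) (by linarith)]

lemma rlKernel_one_convolution {v : ℝ → ℂ} (hv0 : ∀ t ≤ 0, v t = 0) (t : ℝ) :
    (rlKernel 1 ⋆[lsmul ℝ ℝ] v) t = ∫ x in (0:ℝ)..t, v x := by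
  rcases le_or_gt t 0 with ht | ht
  · rw [convolution_eq_zero_of_nonpos _ (fun _ => rlKernel_of_nonpos) hv0 ht,
      intervalIntegral.integral_zero_ae]
    refine ae_of_all _ fun x hx => hv0 x ?_
    rw [uIoc_of_ge ht] at hx
    exact hx.2
  · rw [convolution_eq_swap, intervalIntegral.integral_of_le ht.le, integral_Ioc_eq_integral_Ioo,
      ← setIntegral_eq_integral_of_forall_compl_eq_zero (s := Ioo 0 t)]
    · refine setIntegral_congr_fun measurableSet_Ioo fun x hx => ?_
      simp [rlKernel_one (sub_pos.2 hx.2)]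
    · intro x hx
      rcases le_or_gt x 0 with h | h
      · simp [hv0 x h]
      · have : t ≤ x := by_contra fun h' => hx ⟨h, not_le.1 h'⟩
        simp [rlKernel_of_nonpos (sub_nonpos.2 this)]

lemma rlKernel_convolution_assoc {α lam b : ℝ} (h0 : 0 < α) (hlam : 0 ≤ lam) (hb : 0 < b)
    {f : ℝ → ℂ} (hf : Continuous f) (hfc : HasCompactSupport f) (hf0 : ∀ t ≤ 0, f t = 0) (x : ℝ) :
    ((rlKernel b ⋆[lsmul ℝ ℝ] fracKernelExt α lam) ⋆[mul ℝ ℂ] f) x =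
      (rlKernel b ⋆[lsmul ℝ ℝ] (fracKernelExt α lam ⋆[mul ℝ ℂ] f)) x := by
  have hk := locallyIntegrable_fracKernelExt h0 hlam
  have hg := locallyIntegrable_rlKernel hb
  have hkn : LocallyIntegrable fun x => ‖fracKernelExt α lam x‖ :=
    fun x => (hk x).norm
  have hgn : LocallyIntegrable fun x => ‖rlKernel b x‖ :=
    fun x => (hg x).norm
  refine convolution_assoc _ _ _ _ (fun r y z => ?_)
    (measurable_rlKernel b).aestronglyMeasurable (aestronglyMeasurable_fracKernelExt h0 hlam)
    hf.aestronglyMeasurable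
    (ae_of_all _ fun y => rlKernel_convolutionExistsAt_fracKernelExt h0 hlam hb y)
    (ae_of_all _ fun y => hfc.norm.convolutionExists_right _ hkn hf.norm y) ?_
  · simp [mul_assoc]
  · refine convolutionExistsAt_of_eq_zero_of_nonpos _ hgn (fun t ht => ?_)
      (hfc.norm.continuous_convolution_right _ hkn hf.norm) (fun t ht => ?_) x
    · simp [rlKernel_of_nonpos ht]
    · exact convolution_eq_zero_of_nonpos _ (fun t ht => by simp [fracKernelExt_of_nonpos ht])
        (fun t ht => by simp [hf0 t ht]) ht

/-- The convolution `u = K_λ * f` solves the integrated form of `D^α u = iλu - if`. -/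
lemma rlKernel_convolution_sol {α lam : ℝ} (h0 : 0 < α) (h1 : α < 1) (hlam : 0 ≤ lam)
    {f : ℝ → ℂ} (hf : Continuous f) (hfc : HasCompactSupport f) (hf0 : ∀ t ≤ 0, f t = 0) (x : ℝ) :
    (rlKernel (1 - α) ⋆[lsmul ℝ ℝ] (fracKernelExt α lam ⋆[mul ℝ ℂ] f)) x =
      -Complex.I * (rlKernel 1 ⋆[lsmul ℝ ℝ] f) x + Complex.I * lam *
        (rlKernel 1 ⋆[lsmul ℝ ℝ] (fracKernelExt α lam ⋆[mul ℝ ℂ] f)) x := by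
  rw [← rlKernel_convolution_assoc h0 hlam (sub_pos.2 h1) hf hfc hf0,
    ← rlKernel_convolution_assoc h0 hlam one_pos hf hfc hf0]
  have hcont : Continuous (rlKernel 1 ⋆[lsmul ℝ ℝ] fracKernelExt α lam) := by
    rw [funext (rlKernel_one_convolution fun _ => fracKernelExt_of_nonpos)]
    refine intervalIntegral.continuous_primitive (fun a b => ?_) 0
    rw [intervalIntegrable_iff']
    exact (locallyIntegrable_fracKernelExt h0 hlam).integrableOn_isCompact isCompact_uIcc
  have hi1 := hfc.convolutionExists_right (μ := volume) (mul ℝ ℂ) hcont.locallyIntegrable hf x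
  have hi2 := hfc.convolutionExists_right (lsmul ℝ ℝ) (locallyIntegrable_rlKernel one_pos) hf x
  simp only [ConvolutionExistsAt, mul_apply', lsmul_apply, Complex.real_smul] at hi1 hi2
  rw [convolution_def, convolution_def (f := rlKernel 1) (g := f),
    convolution_def (f := rlKernel 1 ⋆[lsmul ℝ ℝ] fracKernelExt α lam)]
  simp only [mul_apply', lsmul_apply, Complex.real_smul]
  rw [← integral_const_mul, ← integral_const_mul,
    ← integral_add (hi2.const_mul _) (hi1.const_mul _)]
  refine integral_congr_ae (ae_of_all _ fun y => ?_)
  simp only [rlKernel_convolution_fracKernelExt h0 h1 hlam y]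
  ring

lemma integral_exp_mul_rlKernel_ofReal {b : ℝ} (hb : 0 < b) {r : ℝ} (hr : 0 < r) :
    ∫ t : ℝ, Complex.exp (-(r * t)) * rlKernel b t = (1 / (r : ℂ)) ^ (b : ℂ) := by
  have hΓ : (Real.Gamma b : ℂ) ≠ 0 := by exact_mod_cast (Real.Gamma_pos_of_pos hb).ne'
  have h := Complex.integral_cpow_mul_exp_neg_mul_Ioi (a := b) (r := r) (by simpa) hr
  rw [← setIntegral_eq_integral_of_forall_compl_eq_zero (s := Ioi 0)
    (fun x hx => by simp [rlKernel_of_nonpos (not_lt.1 hx)])]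
  rw [Complex.Gamma_ofReal] at h
  rw [← mul_div_cancel_right₀ ((1 / (r : ℂ)) ^ (b : ℂ)) hΓ, ← h, ← integral_div]
  refine setIntegral_congr_fun measurableSet_Ioi fun x hx => ?_
  have hx' : 0 < x := hx
  simp only [rlKernel_of_pos hx']
  push_cast [Complex.ofReal_cpow hx'.le]
  ring

lemma integrable_exp_mul_rlKernel {b : ℝ} (hb : 0 < b) {s : ℂ} (hs : 0 < s.re) :
    Integrable fun t : ℝ => Complex.exp (-(s * t)) * rlKernel b t := by
  have hr : Integrable fun t : ℝ => Complex.exp (-(s.re * t)) * rlKernel b t := by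
    refine Integrable.of_integral_ne_zero ?_
    rw [integral_exp_mul_rlKernel_ofReal hb hs]
    simp [Complex.cpow_eq_zero_iff, hs.ne']
  refine hr.mono ?_ (ae_of_all _ fun t => ?_)
  · have := measurable_rlKernel b
    fun_prop
  · simp [Complex.norm_exp]

/-- The Laplace transform of `g_b` is `s^{-b}`. -/
lemma integral_exp_mul_rlKernel {b : ℝ} (hb : 0 < b) {s : ℂ} (hs : 0 < s.re) :
    ∫ t : ℝ, Complex.exp (-(s * t)) * rlKernel b t = (1 / s) ^ (b : ℂ) := by
  set μ : Measure ℝ := volume.withDensity fun t => ENNReal.ofReal (rlKernel b t) with hμ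
  have hmeas : Measurable fun t => ENNReal.ofReal (rlKernel b t) :=
    (measurable_rlKernel b).ennreal_ofReal
  have hmgf (z : ℂ) : ProbabilityTheory.complexMGF id μ z =
      ∫ t : ℝ, Complex.exp (z * t) * rlKernel b t := by
    rw [ProbabilityTheory.complexMGF, hμ, integral_withDensity_eq_integral_toReal_smul hmeas
      (ae_of_all _ fun _ => ENNReal.ofReal_lt_top)]
    refine integral_congr_ae (ae_of_all _ fun t => ?_)
    simp only [id, ENNReal.toReal_ofReal (rlKernel_nonneg hb t), Complex.real_smul]
    ring
  have hsub : Iio 0 ⊆ ProbabilityTheory.integrableExpSet id μ := fun r hr => by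
    have h := (integrable_exp_mul_rlKernel hb (s := -(r : ℂ)) (by simpa using hr)).norm
    rw [ProbabilityTheory.integrableExpSet, mem_ofPred_eq, hμ,
      integrable_withDensity_iff hmeas (ae_of_all _ fun _ => ENNReal.ofReal_lt_top)]
    refine h.congr (ae_of_all _ fun t => ?_)
    simp [ENNReal.toReal_ofReal (rlKernel_nonneg hb t), Complex.norm_exp,
      abs_of_nonneg (rlKernel_nonneg hb t)]
  have hsub' : Iio 0 ⊆ interior (ProbabilityTheory.integrableExpSet id μ) :=
    isOpen_Iio.subset_interior_iff.2 hsub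
  have hopen : IsOpen {z : ℂ | z.re < 0} := isOpen_lt Complex.continuous_re continuous_const
  have hF : AnalyticOnNhd ℂ (ProbabilityTheory.complexMGF id μ) {z | z.re < 0} :=
    ProbabilityTheory.analyticOnNhd_complexMGF.mono fun z hz => hsub' hz
  have hG : AnalyticOnNhd ℂ (fun z : ℂ => (1 / -z) ^ (b : ℂ)) {z | z.re < 0} := by
    refine DifferentiableOn.analyticOnNhd (fun z hz => ?_) hopen
    have hz' : z.re < 0 := hz
    have hz0 : -z ≠ 0 := fun h => by simp [neg_eq_zero.1 h] at hz'
    refine DifferentiableAt.differentiableWithinAt ?_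
    refine DifferentiableAt.cpow_const (by fun_prop (disch := assumption)) (Or.inl ?_)
    rw [one_div, Complex.inv_re, Complex.neg_re]
    exact div_pos (by linarith) (Complex.normSq_pos.2 hz0)
  have hconn : IsPreconnected {z : ℂ | z.re < 0} :=
    (convex_halfSpace_re_lt 0).isPreconnected
  have htend : Tendsto (fun r : ℝ => (r : ℂ)) (𝓝[≠] (-1)) (𝓝[≠] (-1 : ℂ)) := by
    have := Complex.continuous_ofReal.continuousWithinAt.tendsto_nhdsWithin
      (s := {(-1 : ℝ)}ᶜ) (x := -1) (t := {(-1 : ℂ)}ᶜ) fun r hr h => hr (by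
        simp only [mem_singleton_iff] at h ⊢
        exact_mod_cast h)
    simpa using this
  have hev : ∀ᶠ r : ℝ in 𝓝[≠] (-1), ProbabilityTheory.complexMGF id μ (r : ℂ) =
      (1 / -(r : ℂ)) ^ (b : ℂ) := by
    filter_upwards [nhdsWithin_le_nhds (Iio_mem_nhds (show (-1 : ℝ) < 0 by norm_num))] with r hr
    have h := integral_exp_mul_rlKernel_ofReal hb (r := -r) (neg_pos.2 hr)
    push_cast at h
    simpa [hmgf] using h
  have key := hF.eqOn_of_preconnected_of_frequently_eq hG hconn (z₀ := -1) (by simp)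
    (htend.frequently hev.frequently)
  have := key (x := -s) (by simpa using hs)
  simpa [hmgf] using this

lemma integrable_exp_mul {v : ℝ → ℂ} (hv : Continuous v) (hv0 : ∀ t ≤ 0, v t = 0) {B : ℝ}
    (hB : ∀ t, ‖v t‖ ≤ B) {s : ℂ} (hs : 0 < s.re) :
    Integrable fun t : ℝ => Complex.exp (-(s * t)) * v t := by
  refine Integrable.mono' ((integrable_exp_mul_rlKernel one_pos hs).norm.mul_const B)
    (by fun_prop) (ae_of_all _ fun t => ?_)
  rcases le_or_gt t 0 with ht | ht
  · simp [hv0 t ht, rlKernel_of_nonpos ht]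
  · simp only [rlKernel_one ht, Complex.ofReal_one, mul_one, norm_mul]
    gcongr
    exact hB t

lemma integral_exp_mul_rlKernel_convolution {b : ℝ} (hb : 0 < b) {v : ℝ → ℂ} {s : ℂ}
    (hs : 0 < s.re) (hv : Integrable fun t : ℝ => Complex.exp (-(s * t)) * v t) :
    ∫ t : ℝ, Complex.exp (-(s * t)) * (rlKernel b ⋆[lsmul ℝ ℝ] v) t =
      (1 / s) ^ (b : ℂ) * ∫ t : ℝ, Complex.exp (-(s * t)) * v t := by
  have h := integral_convolution (mul ℝ ℂ) (integrable_exp_mul_rlKernel hb hs) hv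
  rw [integral_exp_mul_rlKernel hb hs, mul_apply'] at h
  rw [← h]
  refine integral_congr_ae (ae_of_all _ fun t => ?_)
  simp only [convolution_def, mul_apply', lsmul_apply, Complex.real_smul]
  rw [← integral_const_mul]
  refine integral_congr_ae (ae_of_all _ fun x => ?_)
  have : Complex.exp (-(s * t)) = Complex.exp (-(s * x)) * Complex.exp (-(s * ↑(t - x))) := by
    rw [← Complex.exp_add]; push_cast; ring_nf
  simp only [this]
  ring

/-- Extremum principle for the Riemann–Liouville derivative `d/dt (g_b * φ)`. -/
lemma deriv_rlKernel_convolution_pos {b : ℝ} (hb : 0 < b) (hb1 : b < 1) {φ : ℝ → ℝ}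
    (hφ : Continuous φ) (hφ0 : ∀ t ≤ 0, φ t = 0) {t₀ d : ℝ} (ht₀ : 0 < t₀) (hM : 0 < φ t₀)
    (hmax : ∀ t ≤ t₀, φ t ≤ φ t₀) (hd : DifferentiableAt ℝ φ t₀)
    (hJ : HasDerivAt (rlKernel b ⋆[lsmul ℝ ℝ] φ) d t₀) : 0 < d := by
  have hb' : 0 < 1 + b := by linarith
  obtain ⟨C, hC0, hC⟩ := hd.hasDerivAt.isBigO_sub.exists_pos
  obtain ⟨δ, hδ, hlip⟩ := Metric.eventually_nhds_iff.1 hC.bound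
  have hint (t : ℝ) : Integrable fun τ => rlKernel b (t - τ) * φ τ := by
    simpa using (convolutionExistsAt_of_eq_zero_of_nonpos (lsmul ℝ ℝ)
      (locallyIntegrable_rlKernel hb) (fun _ => rlKernel_of_nonpos) hφ hφ0 t).integrable_swap
  have hle : ∀ h, 0 < h → h < min δ t₀ →
      φ t₀ * rlKernel (1 + b) t₀ - φ t₀ * rlKernel (1 + b) (t₀ - h) - C * h * rlKernel (1 + b) h ≤
      (rlKernel b ⋆[lsmul ℝ ℝ] φ) t₀ - (rlKernel b ⋆[lsmul ℝ ℝ] φ) (t₀ - h) := by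
    intro h hh hh'
    have hhδ := hh'.trans_le (min_le_left _ _)
    have hht := hh'.trans_le (min_le_right _ _)
    have i1 := integrable_rlKernel_mul one_pos hb ht₀
    have i2 := integrable_rlKernel_mul one_pos hb (sub_pos.2 hht)
    have i3 : Integrable fun τ => rlKernel 1 (τ - (t₀ - h)) * rlKernel b (t₀ - τ) := by
      refine ((integrable_rlKernel_mul one_pos hb hh).comp_sub_right (t₀ - h)).congr
        (ae_of_all _ fun τ => ?_)
      simp only
      ring_nf
    have i12 : Integrable fun τ => φ t₀ * (rlKernel 1 τ * rlKernel b (t₀ - τ)) -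
        φ t₀ * (rlKernel 1 τ * rlKernel b (t₀ - h - τ)) := (i1.const_mul _).sub (i2.const_mul _)
    have e3 : ∫ τ, rlKernel 1 (τ - (t₀ - h)) * rlKernel b (t₀ - τ) = rlKernel (1 + b) h := by
      rw [← integral_rlKernel_mul one_pos hb hh,
        ← integral_sub_right_eq_self (fun x => rlKernel 1 x * rlKernel b (h - x)) (t₀ - h)]
      congr! 4
      ring
    rw [convolution_eq_swap, convolution_eq_swap, ← e3, ← integral_rlKernel_mul one_pos hb ht₀,
      ← integral_rlKernel_mul one_pos hb (sub_pos.2 hht)]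
    simp only [lsmul_apply, smul_eq_mul]
    rw [← integral_const_mul, ← integral_const_mul, ← integral_const_mul,
      ← integral_sub (i1.const_mul _) (i2.const_mul _),
      ← integral_sub i12 (i3.const_mul _),
      ← integral_sub (hint _) (hint _)]
    refine integral_mono_ae (i12.sub (i3.const_mul _)) ((hint _).sub (hint _)) ?_
    filter_upwards [compl_mem_ae_iff.2 (measure_singleton (t₀ - h))] with τ hτ
    rcases le_or_gt τ 0 with h1 | h1
    · simp [hφ0 τ h1, rlKernel_of_nonpos h1,
        rlKernel_of_nonpos (show τ - (t₀ - h) ≤ 0 by linarith)]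
    rw [rlKernel_one h1]
    rcases lt_or_gt_of_ne hτ with h2 | h2
    · rw [rlKernel_of_nonpos (show τ - (t₀ - h) ≤ 0 by linarith)]
      have := rlKernel_anti hb hb1 (show 0 < t₀ - h - τ by linarith)
        (show t₀ - h - τ ≤ t₀ - τ by linarith)
      nlinarith [hmax τ (by linarith)]
    rw [rlKernel_of_nonpos (show t₀ - h - τ ≤ 0 by linarith), rlKernel_one (sub_pos.2 h2)]
    rcases le_or_gt t₀ τ with h3 | h3
    · simp [rlKernel_of_nonpos (sub_nonpos.2 h3)]
    · have hdist : |τ - t₀| ≤ h := abs_le.2 ⟨by linarith, by linarith⟩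
      have h4 := hlip (y := τ) (by rw [Real.dist_eq]; linarith)
      rw [Real.norm_eq_abs, Real.norm_eq_abs] at h4
      have h5 := (abs_le.1 h4).1
      have h6 : C * |τ - t₀| ≤ C * h := by gcongr
      nlinarith [rlKernel_nonneg hb (t₀ - τ)]
  have hG : HasDerivAt (rlKernel (1 + b)) (b * t₀ ^ (b - 1) / Real.Gamma (1 + b)) t₀ := by
    refine HasDerivAt.congr_of_eventuallyEq
      ((Real.hasDerivAt_rpow_const (p := b) (Or.inl ht₀.ne')).div_const _) ?_
    filter_upwards [lt_mem_nhds ht₀] with t ht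
    rw [rlKernel_of_pos ht, add_sub_cancel_left]
  have hG0 : Tendsto (fun h => -(C * rlKernel (1 + b) h)) (𝓝[>] 0) (𝓝 0) := by
    have : Tendsto (fun h : ℝ => -(C * (h ^ b / Real.Gamma (1 + b)))) (𝓝[>] 0)
        (𝓝 (-(C * (0 ^ b / Real.Gamma (1 + b))))) := by
      refine Tendsto.mono_left ?_ nhdsWithin_le_nhds
      exact (((Real.continuous_rpow_const hb.le).div_const _).const_mul C).neg.tendsto 0
    rw [Real.zero_rpow hb.ne', zero_div, mul_zero, neg_zero] at this
    refine this.congr' ?_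
    filter_upwards [self_mem_nhdsWithin] with h hh
    rw [rlKernel_of_pos hh, add_sub_cancel_left]
  have hH := (hJ.sub (hG.const_mul (φ t₀)))
  have hlim := (HasDerivAt.scomp_of_eq (h := fun h => t₀ - h) (0 : ℝ) hH
    ((hasDerivAt_id (0 : ℝ)).const_sub t₀) (by simp)).neg.tendsto_slope_zero_right
  have h := le_of_tendsto_of_tendsto hG0 hlim ?_
  · have h1 : 0 < φ t₀ * (b * t₀ ^ (b - 1) / Real.Gamma (1 + b)) := by
      have := Real.Gamma_pos_of_pos hb'
      positivity
    simp at h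
    linarith
  · filter_upwards [Ioo_mem_nhdsGT (lt_min hδ ht₀)] with h hh
    have := hle h hh.1 hh.2
    have h0 := hh.1
    simp only [smul_eq_mul, Pi.neg_apply, Function.comp_apply, Pi.sub_apply, zero_add, sub_zero]
    rw [inv_mul_eq_div, le_div_iff₀ h0]
    linarith

lemma apply_ne_zero_of_norm_convolution_max {α lam : ℝ} (h0 : 0 < α) (h1 : α < 1) (hlam : 0 ≤ lam)
    {f : ℝ → ℂ} (hf : ContDiff ℝ 1 f) (hfc : HasCompactSupport f) (hf0 : ∀ t ≤ 0, f t = 0)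
    {t₀ : ℝ} (ht₀ : 0 < t₀) (hu : (fracKernelExt α lam ⋆[mul ℝ ℂ] f) t₀ ≠ 0)
    (hmax : ∀ t ≤ t₀, ‖(fracKernelExt α lam ⋆[mul ℝ ℂ] f) t‖ ≤
      ‖(fracKernelExt α lam ⋆[mul ℝ ℂ] f) t₀‖) : f t₀ ≠ 0 := by
  intro hft
  have hsol := rlKernel_convolution_sol h0 h1 hlam hf.continuous hfc hf0
  have hud : ContDiff ℝ 1 (fracKernelExt α lam ⋆[mul ℝ ℂ] f) := by
    exact_mod_cast hfc.contDiff_convolution_right (n := 1) (mul ℝ ℂ)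
      (locallyIntegrable_fracKernelExt h0 hlam) hf
  have hu0 (t : ℝ) (ht : t ≤ 0) : (fracKernelExt α lam ⋆[mul ℝ ℂ] f) t = 0 :=
    convolution_eq_zero_of_nonpos _ (fun _ => fracKernelExt_of_nonpos) hf0 ht
  generalize (fracKernelExt α lam ⋆[mul ℝ ℂ] f) = u at *
  have hv : Continuous fun t => -Complex.I * f t + Complex.I * lam * u t :=
    (hf.continuous.const_mul _).add (hud.continuous.const_mul _)
  have hJ : HasDerivAt (rlKernel (1 - α) ⋆[lsmul ℝ ℝ] u) (Complex.I * lam * u t₀) t₀ := by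
    have := intervalIntegral.integral_hasDerivAt_right (a := 0) (hv.intervalIntegrable 0 t₀)
      (hv.stronglyMeasurableAtFilter _ _) hv.continuousAt
    rw [hft, mul_zero, zero_add] at this
    refine this.congr_of_eventuallyEq (Eventually.of_forall fun t => ?_)
    simp only
    rw [hsol, rlKernel_one_convolution hf0, rlKernel_one_convolution hu0,
      intervalIntegral.integral_add, intervalIntegral.integral_const_mul,
      intervalIntegral.integral_const_mul]
    · exact (hf.continuous.const_mul _).intervalIntegrable _ _
    · exact (hud.continuous.const_mul _).intervalIntegrable _ _
  set L : ℂ →L[ℝ] ℝ := innerSL ℝ (u t₀) with hL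
  have hLu : L (u t₀) = ‖u t₀‖ ^ 2 := by simp [hL]
  have hconv : rlKernel (1 - α) ⋆[lsmul ℝ ℝ] (fun t => L (u t)) =
      fun t => L ((rlKernel (1 - α) ⋆[lsmul ℝ ℝ] u) t) := by
    funext t
    have := convolutionExistsAt_of_eq_zero_of_nonpos (lsmul ℝ ℝ)
      (locallyIntegrable_rlKernel (sub_pos.2 h1)) (fun _ => rlKernel_of_nonpos) hud.continuous hu0 t
    rw [convolution_def, convolution_def, ← L.integral_comp_comm this]
    simp only [lsmul_apply, map_smul]
  have hJ' : HasDerivAt (rlKernel (1 - α) ⋆[lsmul ℝ ℝ] (fun t => L (u t)))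
      (L (Complex.I * lam * u t₀)) t₀ := by
    rw [hconv]
    exact L.hasFDerivAt.comp_hasDerivAt t₀ hJ
  have hpos := deriv_rlKernel_convolution_pos (sub_pos.2 h1) (by linarith)
    (φ := fun t => L (u t)) (L.continuous.comp hud.continuous) (fun t ht => by simp [hu0 t ht]) ht₀
    (by rw [hLu]; positivity) (fun t ht => ?_)
    (L.differentiableAt.comp t₀ (hud.differentiable (by simp) t₀)) hJ'
  · have : L (Complex.I * lam * u t₀) = 0 := by
      simp [hL, Complex.inner]
      ring
    exact hpos.ne' this
  · rw [hLu]
    calc L (u t) ≤ ‖u t₀‖ * ‖u t‖ := real_inner_le_norm (u t₀) (u t)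
      _ ≤ ‖u t₀‖ * ‖u t₀‖ := by gcongr; exact hmax t ht
      _ = _ := (sq _).symm

lemma exists_norm_convolution_le {α lam : ℝ} (h0 : 0 < α) (h1 : α < 1) (hlam : 0 ≤ lam)
    {f : ℝ → ℂ} (hf : ContDiff ℝ 1 f) (hfc : HasCompactSupport f) (hf0 : ∀ t ≤ 0, f t = 0) :
    ∃ B, ∀ t, ‖(fracKernelExt α lam ⋆[mul ℝ ℂ] f) t‖ ≤ B := by
  have huc : Continuous (fracKernelExt α lam ⋆[mul ℝ ℂ] f) :=
    hfc.continuous_convolution_right _ (locallyIntegrable_fracKernelExt h0 hlam) hf.continuous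
  have hu0 (t : ℝ) (ht : t ≤ 0) : (fracKernelExt α lam ⋆[mul ℝ ℂ] f) t = 0 :=
    convolution_eq_zero_of_nonpos _ (fun _ => fracKernelExt_of_nonpos) hf0 ht
  have hne {t₀ : ℝ} := apply_ne_zero_of_norm_convolution_max (t₀ := t₀) h0 h1 hlam hf hfc hf0
  generalize (fracKernelExt α lam ⋆[mul ℝ ℂ] f) = u at *
  obtain ⟨R, hR⟩ := hfc.isCompact.bddAbove
  obtain ⟨B, hB⟩ := (isCompact_Icc (a := 0) (b := R)).exists_bound_of_continuousOn huc.continuousOn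
  refine ⟨max B 0, fun t => ?_⟩
  rcases le_or_gt t 0 with ht | ht
  · simp [hu0 t ht]
  obtain ⟨t₀, ht₀, hmax⟩ := (isCompact_Icc (a := 0) (b := t)).exists_isMaxOn
    (nonempty_Icc.2 ht.le) huc.norm.continuousOn
  refine (hmax (right_mem_Icc.2 ht.le)).trans ?_
  by_cases hz : u t₀ = 0
  · simp [hz]
  have hpos : 0 < t₀ := lt_of_not_ge fun h => hz (hu0 _ h)
  have hft := hne hpos hz fun x hx => by
    rcases le_or_gt x 0 with h | h
    · simp [hu0 x h]
    · exact hmax ⟨h.le, hx.trans ht₀.2⟩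
  exact (hB t₀ ⟨hpos.le, hR (subset_tsupport _ hft)⟩).trans (le_max_left _ _)

lemma convSol_eq_convolution {α lam : ℝ} {f : ℝ → ℂ} (hf0 : ∀ t ≤ 0, f t = 0) {t : ℝ} (ht : 0 < t) :
    convSol α lam f t = (fracKernelExt α lam ⋆[mul ℝ ℂ] f) t := by
  rw [convSol, intervalIntegral.integral_of_le ht.le, integral_Ioc_eq_integral_Ioo,
    convolution_eq_swap]
  refine Eq.trans ?_ (setIntegral_eq_integral_of_forall_compl_eq_zero (s := Ioo 0 t) ?_)
  · refine setIntegral_congr_fun measurableSet_Ioo fun x hx => ?_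
    simp [fracKernelExt, hx.2]
  · intro x hx
    rcases le_or_gt x 0 with h | h
    · simp [hf0 x h]
    · have : t ≤ x := le_of_not_gt fun h' => hx ⟨h, h'⟩
      rw [fracKernelExt_of_nonpos (sub_nonpos.2 this), map_zero, zero_apply]

lemma I_mul_cpow_add_ne_zero {α : ℝ} (h0 : 0 < α) (h1 : α < 1) (lam : ℝ) {s : ℂ} (hs : 0 < s.re) :
    Complex.I * s ^ (α : ℂ) + lam ≠ 0 := by
  intro h
  have him := congrArg Complex.im h
  have hs0 : s ≠ 0 := fun h => by simp [h] at hs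
  have harg := Complex.abs_arg_lt_pi_div_two_iff.2 (Or.inl hs)
  have hcos : 0 < Real.cos (s.arg * α) := by
    have : |s.arg * α| < Real.pi / 2 := by
      rw [abs_mul, abs_of_pos h0]
      exact (mul_le_of_le_one_right (abs_nonneg _) h1.le).trans_lt harg
    exact Real.cos_pos_of_mem_Ioo (abs_lt.1 this)
  have hre : (s ^ (α : ℂ)).re = ‖s‖ ^ α * Real.cos (s.arg * α) := by
    simp [Complex.cpow_ofReal_re]
  simp [hre, hcos.ne', Real.rpow_eq_zero_iff_of_nonneg, hs0] at him

lemma integral_exp_mul_convolution {α lam : ℝ} (h0 : 0 < α) (h1 : α < 1) (hlam : 0 ≤ lam)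
    {f : ℝ → ℂ} (hf : ContDiff ℝ 1 f) (hfc : HasCompactSupport f) (hf0 : ∀ t ≤ 0, f t = 0)
    {s : ℂ} (hs : 0 < s.re) :
    (Complex.I * s ^ (α : ℂ) + lam) *
        ∫ t : ℝ, Complex.exp (-(s * t)) * (fracKernelExt α lam ⋆[mul ℝ ℂ] f) t =
      ∫ t : ℝ, Complex.exp (-(s * t)) * f t := by
  obtain ⟨A, hA⟩ := hf.continuous.bounded_above_of_compact_support hfc
  obtain ⟨B, hB⟩ := exists_norm_convolution_le h0 h1 hlam hf hfc hf0
  have hfi := integrable_exp_mul hf.continuous hf0 hA hs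
  have huc : Continuous (fracKernelExt α lam ⋆[mul ℝ ℂ] f) :=
    hfc.continuous_convolution_right _ (locallyIntegrable_fracKernelExt h0 hlam) hf.continuous
  have hui := integrable_exp_mul huc
    (fun t => convolution_eq_zero_of_nonpos _ (fun _ => fracKernelExt_of_nonpos) hf0) hB hs
  have hsol := rlKernel_convolution_sol h0 h1 hlam hf.continuous hfc hf0
  have hs0 : s ≠ 0 := fun h => by simp [h] at hs
  have hU := integral_exp_mul_rlKernel_convolution (sub_pos.2 h1) hs hui
  have hsum (t : ℝ) : Complex.exp (-(s * t)) * (-Complex.I * f t +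
      Complex.I * lam * (fracKernelExt α lam ⋆[mul ℝ ℂ] f) t) =
      -Complex.I * (Complex.exp (-(s * t)) * f t) + Complex.I * lam *
      (Complex.exp (-(s * t)) * (fracKernelExt α lam ⋆[mul ℝ ℂ] f) t) := by ring
  have hv : Integrable fun t : ℝ => Complex.exp (-(s * t)) * (-Complex.I * f t +
      Complex.I * lam * (fracKernelExt α lam ⋆[mul ℝ ℂ] f) t) := by
    simp only [hsum]
    exact (hfi.const_mul _).add (hui.const_mul _)
  have hV := integral_exp_mul_rlKernel_convolution one_pos hs hv
  simp only [hsum] at hV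
  rw [integral_add (hfi.const_mul _) (hui.const_mul _), integral_const_mul,
    integral_const_mul] at hV
  have hJ : rlKernel (1 - α) ⋆[lsmul ℝ ℝ] (fracKernelExt α lam ⋆[mul ℝ ℂ] f) =
      rlKernel 1 ⋆[lsmul ℝ ℝ] fun t => -Complex.I * f t +
        Complex.I * lam * (fracKernelExt α lam ⋆[mul ℝ ℂ] f) t := by
    funext t
    have hu0 (t : ℝ) (ht : t ≤ 0) : (fracKernelExt α lam ⋆[mul ℝ ℂ] f) t = 0 :=
      convolution_eq_zero_of_nonpos _ (fun _ => fracKernelExt_of_nonpos) hf0 ht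
    rw [hsol, rlKernel_one_convolution hf0, rlKernel_one_convolution hu0,
      rlKernel_one_convolution fun t ht => by simp [hf0 t ht, hu0 t ht],
      intervalIntegral.integral_add, intervalIntegral.integral_const_mul,
      intervalIntegral.integral_const_mul]
    · exact (hf.continuous.const_mul _).intervalIntegrable _ _
    · exact (huc.const_mul _).intervalIntegrable _ _
  rw [hJ, hV] at hU
  have hpow : (1 / s) ^ ((1 - α : ℝ) : ℂ) = 1 / s * s ^ (α : ℂ) := by
    have harg : s.arg ≠ Real.pi := fun h => by
      have := Complex.abs_arg_lt_pi_div_two_iff.2 (Or.inl hs)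
      rw [h, abs_of_pos Real.pi_pos] at this
      linarith [Real.pi_pos]
    rw [one_div, Complex.inv_cpow _ _ harg, ← Complex.cpow_neg]
    push_cast
    rw [neg_sub, sub_eq_add_neg, Complex.cpow_add _ _ hs0, Complex.cpow_neg_one, mul_comm]
  rw [hpow, Complex.ofReal_one, Complex.cpow_one, mul_assoc (1 / s)] at hU
  have hU' := mul_left_cancel₀ (one_div_ne_zero hs0) hU
  linear_combination (-Complex.I) * hU' - ((∫ t : ℝ, Complex.exp (-(s * t)) * f t) -
    lam * ∫ t : ℝ, Complex.exp (-(s * t)) * (fracKernelExt α lam ⋆[mul ℝ ℂ] f) t) * Complex.I_sq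

end

/-- For `0 < α < 1`, `λ ≥ 0` and `f` twice continuously differentiable with compact support
in `(0,∞)`, the Laplace transform of `u(t) = ∫_0^t K_λ(t-τ) f(τ) dτ` satisfies
`∫_0^∞ e^{-st} u(t) dt = (1/(i s^α + λ)) ∫_0^∞ e^{-st} f(t) dt` for `Re s > 0`,
with `s^α` the principal branch and `i s^α + λ ≠ 0`. -/
theorem laplace_convSol (α lam : ℝ) (h0 : 0 < α) (h1 : α < 1) (hlam : 0 ≤ lam)
    (f : ℝ → ℂ) (hf : ContDiff ℝ 2 f) (hfc : HasCompactSupport f)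
    (hfs : tsupport f ⊆ Set.Ioi 0) :
    ∀ s : ℂ, 0 < s.re →
      Complex.I * s ^ (α : ℂ) + (lam : ℂ) ≠ 0 ∧
      ∫ t in Set.Ioi (0:ℝ), Complex.exp (-(s * (t : ℂ))) * convSol α lam f t =
        (Complex.I * s ^ (α : ℂ) + (lam : ℂ))⁻¹ *
          ∫ t in Set.Ioi (0:ℝ), Complex.exp (-(s * (t : ℂ))) * f t := by
  intro s hs
  have hne := I_mul_cpow_add_ne_zero h0 h1 lam hs
  have hf0 (t : ℝ) (ht : t ≤ 0) : f t = 0 :=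
    image_eq_zero_of_notMem_tsupport fun h => not_lt.2 ht (hfs h)
  have hu0 (t : ℝ) (ht : t ≤ 0) :
      MeasureTheory.convolution (fracKernelExt α lam) f (ContinuousLinearMap.mul ℝ ℂ)
        MeasureTheory.volume t = 0 :=
    convolution_eq_zero_of_nonpos _ (fun _ => fracKernelExt_of_nonpos) hf0 ht
  refine ⟨hne, ?_⟩
  have h := integral_exp_mul_convolution h0 h1 hlam (hf.of_le one_le_two) hfc hf0 hs
  have hIoi {v : ℝ → ℂ} (hv : ∀ t ≤ 0, v t = 0) :
      ∫ t in Set.Ioi (0:ℝ), Complex.exp (-(s * (t : ℂ))) * v t =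
        ∫ t : ℝ, Complex.exp (-(s * (t : ℂ))) * v t :=
    MeasureTheory.setIntegral_eq_integral_of_forall_compl_eq_zero
      fun t ht => by simp [hv t (not_lt.1 ht)]
  rw [← hIoi hf0, ← hIoi hu0] at h
  rw [← h, inv_mul_cancel_left₀ hne]
  refine MeasureTheory.setIntegral_congr_fun measurableSet_Ioi fun t ht => ?_
  simp only [convSol_eq_convolution hf0 ht]
end

section
/- Under the Hilbert space setup below, let H(z) := ∑_{k=1}^∞ (μ_k + i z)^{−1} R ∘ Q_k ∘ E for z ∉ {i μ_k : k ≥ 1} (the series converges in operator norm there). Then: (1) for every j ≥ 1, (μ_j + i z) H(z) converges in operator norm to R ∘ Q_j ∘ E as z → i μ_j (z ≠ i μ_j); and (2) for every c > 0 with c ∉ {μ_k : k ≥ 1}, (c + i z) H(z) converges in operator norm to 0 as z → i c. -/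
open Filter Topology

section OrthogonalProjections

variable {ι H H₁ H₂ : Type*}
  [NormedAddCommGroup H] [InnerProductSpace ℂ H]
  [NormedAddCommGroup H₁] [InnerProductSpace ℂ H₁]
  [NormedAddCommGroup H₂] [InnerProductSpace ℂ H₂]

lemma norm_sum_sq_of_pairwise_inner_eq_zero (v : ι → H)
    (hv : ∀ k l, k ≠ l → inner ℂ (v k) (v l) = 0) (s : Finset ι) :
    ‖∑ k ∈ s, v k‖ ^ 2 = ∑ k ∈ s, ‖v k‖ ^ 2 := by
  classical
  induction s using Finset.induction_on with
  | empty => simp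
  | insert a s ha ih =>
    have h : inner ℂ (v a) (∑ k ∈ s, v k) = 0 := by
      rw [inner_sum]
      exact Finset.sum_eq_zero fun k hk => hv a k fun h => ha (h ▸ hk)
    have := norm_add_sq_eq_norm_sq_add_norm_sq_of_inner_eq_zero _ _ h
    rw [Finset.sum_insert ha, Finset.sum_insert ha, ← ih]
    linarith

variable [CompleteSpace H] {Q : ι → H →L[ℂ] H}

lemma inner_apply_apply_of_comp_eq_zero (hsa : ∀ k, IsSelfAdjoint (Q k))
    (horth : ∀ k l, k ≠ l → (Q k).comp (Q l) = 0) {k l : ι} (hkl : k ≠ l) (x y : H) :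
    inner ℂ (Q k x) (Q l y) = 0 := by
  rw [← ContinuousLinearMap.adjoint_inner_right, (hsa k).adjoint_eq,
    ← ContinuousLinearMap.comp_apply, horth k l hkl]
  simp

/-- Bessel's inequality for a family of mutually orthogonal projections. -/
lemma sum_norm_sq_apply_le (hidem : ∀ k, (Q k).comp (Q k) = Q k)
    (hsa : ∀ k, IsSelfAdjoint (Q k)) (horth : ∀ k l, k ≠ l → (Q k).comp (Q l) = 0)
    (s : Finset ι) (x : H) : ∑ k ∈ s, ‖Q k x‖ ^ 2 ≤ ‖x‖ ^ 2 := by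
  have hpyth := norm_sum_sq_of_pairwise_inner_eq_zero (fun k => Q k x)
    (fun k l hkl => inner_apply_apply_of_comp_eq_zero hsa horth hkl x x) s
  have hinner : inner ℂ (∑ k ∈ s, Q k x) x = ((∑ k ∈ s, ‖Q k x‖ ^ 2 : ℝ) : ℂ) := by
    rw [sum_inner]
    push_cast
    refine Finset.sum_congr rfl fun k _ => ?_
    have h : Q k x = Q k (Q k x) := by rw [← ContinuousLinearMap.comp_apply, hidem k]
    rw [h, ← ContinuousLinearMap.adjoint_inner_right, (hsa k).adjoint_eq, ← h,
      inner_self_eq_norm_sq_to_K]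
    rfl
  have hcs := norm_inner_le_norm (𝕜 := ℂ) (∑ k ∈ s, Q k x) x
  rw [hinner, Complex.norm_real, ← hpyth, Real.norm_of_nonneg (by positivity)] at hcs
  rw [← hpyth]
  refine pow_le_pow_left₀ (norm_nonneg _) ?_ 2
  by_contra! hlt
  nlinarith [norm_nonneg x]

lemma norm_sum_smul_le_of_orthogonal (hidem : ∀ k, (Q k).comp (Q k) = Q k)
    (hsa : ∀ k, IsSelfAdjoint (Q k)) (horth : ∀ k l, k ≠ l → (Q k).comp (Q l) = 0)
    (s : Finset ι) {a : ι → ℂ} {M : ℝ} (hM : 0 ≤ M) (ha : ∀ k ∈ s, ‖a k‖ ≤ M) :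
    ‖∑ k ∈ s, a k • Q k‖ ≤ M := by
  refine ContinuousLinearMap.opNorm_le_bound _ hM fun x => ?_
  refine le_of_sq_le_sq ?_ (by positivity)
  rw [sum_apply]
  simp only [smul_apply]
  rw [norm_sum_sq_of_pairwise_inner_eq_zero (fun k => a k • Q k x) fun k l hkl => by
    rw [inner_smul_left, inner_smul_right,
      inner_apply_apply_of_comp_eq_zero hsa horth hkl, mul_zero, mul_zero]]
  calc ∑ k ∈ s, ‖a k • Q k x‖ ^ 2 ≤ ∑ k ∈ s, M ^ 2 * ‖Q k x‖ ^ 2 := by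
        refine Finset.sum_le_sum fun k hk => ?_
        rw [norm_smul, mul_pow]
        have := ha k hk
        gcongr
    _ ≤ (M * ‖x‖) ^ 2 := by
        rw [← Finset.mul_sum, mul_pow]
        gcongr
        exact sum_norm_sq_apply_le hidem hsa horth s x

lemma norm_sum_smul_comp_le (E : H₁ →L[ℂ] H) (R : H →L[ℂ] H₂)
    (hidem : ∀ k, (Q k).comp (Q k) = Q k)
    (hsa : ∀ k, IsSelfAdjoint (Q k)) (horth : ∀ k l, k ≠ l → (Q k).comp (Q l) = 0)
    (s : Finset ι) {a : ι → ℂ} {M : ℝ} (hM : 0 ≤ M) (ha : ∀ k ∈ s, ‖a k‖ ≤ M) :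
    ‖∑ k ∈ s, a k • R.comp ((Q k).comp E)‖ ≤ ‖R‖ * (M * ‖E‖) := by
  have h : ∑ k ∈ s, a k • R.comp ((Q k).comp E) = R.comp ((∑ k ∈ s, a k • Q k).comp E) := by
    ext x
    simp
  rw [h]
  refine (ContinuousLinearMap.opNorm_comp_le _ _).trans ?_
  gcongr
  refine (ContinuousLinearMap.opNorm_comp_le _ _).trans ?_
  gcongr
  exact norm_sum_smul_le_of_orthogonal hidem hsa horth s hM ha

lemma summable_smul_comp [CompleteSpace H₂] (E : H₁ →L[ℂ] H) (R : H →L[ℂ] H₂)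
    (hidem : ∀ k, (Q k).comp (Q k) = Q k)
    (hsa : ∀ k, IsSelfAdjoint (Q k)) (horth : ∀ k l, k ≠ l → (Q k).comp (Q l) = 0)
    {a : ι → ℂ} (ha : Tendsto a cofinite (𝓝 0)) :
    Summable fun k => a k • R.comp ((Q k).comp E) := by
  rw [summable_iff_vanishing_norm]
  intro ε hε
  set δ : ℝ := ε / (‖R‖ * ‖E‖ + 1) with hδ
  have hδ0 : 0 < δ := by positivity
  have hfin : {k | ¬ ‖a k‖ < δ}.Finite := by
    have := (tendsto_zero_iff_norm_tendsto_zero.1 ha).eventually_lt_const hδ0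
    exact this
  refine ⟨hfin.toFinset, fun t ht => ?_⟩
  have hb := norm_sum_smul_comp_le E R hidem hsa horth t hδ0.le (a := a) fun k hk => by
    by_contra hcon
    refine Finset.disjoint_left.1 ht hk (hfin.mem_toFinset.2 ?_)
    exact fun h => hcon h.le
  have hmul : δ * (‖R‖ * ‖E‖ + 1) = ε := div_mul_cancel₀ _ (by positivity)
  nlinarith

lemma norm_tsum_smul_comp_le [CompleteSpace H₂] (E : H₁ →L[ℂ] H) (R : H →L[ℂ] H₂)
    (hidem : ∀ k, (Q k).comp (Q k) = Q k)
    (hsa : ∀ k, IsSelfAdjoint (Q k)) (horth : ∀ k l, k ≠ l → (Q k).comp (Q l) = 0)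
    {a : ι → ℂ} (ha : Tendsto a cofinite (𝓝 0)) {M : ℝ} (hM : 0 ≤ M) (haM : ∀ k, ‖a k‖ ≤ M) :
    ‖∑' k, a k • R.comp ((Q k).comp E)‖ ≤ ‖R‖ * (M * ‖E‖) :=
  le_of_tendsto' (summable_smul_comp E R hidem hsa horth ha).hasSum.norm fun s =>
    norm_sum_smul_comp_le E R hidem hsa horth s hM fun k _ => haM k

end OrthogonalProjections

lemma tendsto_inv_add_I_mul_cofinite {μ : ℕ → ℝ} (htop : Tendsto μ atTop atTop) (z : ℂ) :
    Tendsto (fun k => ((μ k : ℂ) + Complex.I * z)⁻¹) cofinite (𝓝 0) := by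
  rw [Nat.cofinite_eq_atTop]
  refine tendsto_inv₀_cobounded.comp (tendsto_norm_atTop_iff_cobounded.1 ?_)
  refine tendsto_atTop_mono (fun k => ?_) (tendsto_atTop_add_const_right _ (-‖z‖) htop)
  have h := norm_sub_le_norm_add (μ k : ℂ) (Complex.I * z)
  rw [norm_mul, Complex.norm_I, one_mul, Complex.norm_real] at h
  linarith [Real.le_norm_self (μ k)]

/-- A sequence tending to infinity keeps a positive distance to each point it avoids. -/
lemma exists_pos_le_abs_sub_of_tendsto_atTop {μ : ℕ → ℝ} (htop : Tendsto μ atTop atTop) (c : ℝ) :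
    ∃ δ > 0, ∀ k, μ k ≠ c → δ ≤ |μ k - c| := by
  obtain ⟨N, hN⟩ := eventually_atTop.1 (htop.eventually_ge_atTop (c + 1))
  have hev : ∀ᶠ δ in 𝓝[>] (0 : ℝ), ∀ k ∈ Finset.range N, μ k ≠ c → δ ≤ |μ k - c| := by
    rw [Finset.eventually_all]
    intro k _
    by_cases hk : μ k = c
    · simp [hk]
    · filter_upwards [nhdsWithin_le_nhds (eventually_le_nhds (abs_pos.2 (sub_ne_zero.2 hk)))]
        with δ hδ _ using hδ
  obtain ⟨δ, ⟨hδ, hδ1⟩, hδ0⟩ := ((hev.and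
    (nhdsWithin_le_nhds (eventually_le_nhds one_pos))).and self_mem_nhdsWithin).exists
  refine ⟨δ, hδ0, fun k hk => ?_⟩
  rcases lt_or_ge k N with h | h
  · exact hδ k (Finset.mem_range.2 h) hk
  · have := hN k h
    have := le_abs_self (μ k - c)
    linarith

/-- Removing the terms with a pole at `ic` leaves a series that is bounded near `ic`. -/
lemma tendsto_smul_tsum_ite {H H₁ H₂ : Type*}
    [NormedAddCommGroup H] [InnerProductSpace ℂ H] [CompleteSpace H]
    [NormedAddCommGroup H₁] [InnerProductSpace ℂ H₁]
    [NormedAddCommGroup H₂] [InnerProductSpace ℂ H₂] [CompleteSpace H₂]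
    (E : H₁ →L[ℂ] H) (R : H →L[ℂ] H₂) {Q : ℕ → H →L[ℂ] H}
    (hidem : ∀ k, (Q k).comp (Q k) = Q k) (hsa : ∀ k, IsSelfAdjoint (Q k))
    (horth : ∀ k l, k ≠ l → (Q k).comp (Q l) = 0)
    {μ : ℕ → ℝ} (htop : Tendsto μ atTop atTop) (c : ℝ) :
    Tendsto
      (fun z : ℂ => ((c : ℂ) + Complex.I * z) •
        ∑' k : ℕ, (if μ k = c then 0 else ((μ k : ℂ) + Complex.I * z)⁻¹) •
          (R.comp ((Q k).comp E)))
      (𝓝 ((c : ℂ) * Complex.I)) (𝓝 0) := by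
  obtain ⟨δ, hδ0, hδ⟩ := exists_pos_le_abs_sub_of_tendsto_atTop htop c
  have hlim : Tendsto (fun z : ℂ => (c : ℂ) + Complex.I * z) (𝓝 ((c : ℂ) * Complex.I)) (𝓝 0) := by
    have h : Continuous fun z : ℂ => (c : ℂ) + Complex.I * z := by fun_prop
    have h' := h.tendsto ((c : ℂ) * Complex.I)
    rwa [mul_left_comm, Complex.I_mul_I, mul_neg_one, add_neg_cancel] at h'
  refine NormedField.tendsto_zero_smul_of_tendsto_zero_of_bounded hlim ?_
  refine isBoundedUnder_of_eventually_le (a := ‖R‖ * ((δ / 2)⁻¹ * ‖E‖)) ?_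
  filter_upwards [(tendsto_zero_iff_norm_tendsto_zero.1 hlim).eventually_le_const (half_pos hδ0)]
    with z hz
  refine norm_tsum_smul_comp_le E R hidem hsa horth ?_ (by positivity) fun k => ?_
  · refine squeeze_zero_norm (fun k => ?_)
      (tendsto_zero_iff_norm_tendsto_zero.1 (tendsto_inv_add_I_mul_cofinite htop z))
    split_ifs
    · simp
    · exact le_rfl
  · split_ifs with hk
    · rw [norm_zero]; positivity
    · rw [norm_inv]
      gcongr
      have h := norm_sub_le_norm_add ((μ k - c : ℝ) : ℂ) ((c : ℂ) + Complex.I * z)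
      rw [Complex.norm_real, Real.norm_eq_abs] at h
      have he : ((μ k - c : ℝ) : ℂ) + ((c : ℂ) + Complex.I * z) = (μ k : ℂ) + Complex.I * z := by
        push_cast; ring
      rw [he] at h
      linarith [hδ k hk]

/-- Under the Hilbert space setup, with `H(z) = ∑_k (μ_k + iz)⁻¹ R ∘ Q_k ∘ E`:
(1) `(μ_j + iz) H(z) → R ∘ Q_j ∘ E` in operator norm as `z → i μ_j`, `z ≠ i μ_j`;
(2) for `c > 0` not among the `μ_k`, `(c + iz) H(z) → 0` in operator norm as `z → ic`. -/
theorem operator_series_residues {H H₁ H₂ : Type*}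
    [NormedAddCommGroup H] [InnerProductSpace ℂ H] [CompleteSpace H]
    [NormedAddCommGroup H₁] [InnerProductSpace ℂ H₁] [CompleteSpace H₁]
    [NormedAddCommGroup H₂] [InnerProductSpace ℂ H₂] [CompleteSpace H₂]
    (E : H₁ →L[ℂ] H) (R : H →L[ℂ] H₂) (Q : ℕ → H →L[ℂ] H)
    (hidem : ∀ k, (Q k).comp (Q k) = Q k) (hsa : ∀ k, IsSelfAdjoint (Q k))
    (hne : ∀ k, Q k ≠ 0) (horth : ∀ k l, k ≠ l → (Q k).comp (Q l) = 0)
    (μ : ℕ → ℝ) (hpos : ∀ k, 0 < μ k) (hmono : StrictMono μ)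
    (htop : Tendsto μ atTop atTop) :
    (∀ j : ℕ,
      Tendsto
        (fun z : ℂ => ((μ j : ℂ) + Complex.I * z) •
          ∑' k : ℕ, ((μ k : ℂ) + Complex.I * z)⁻¹ • (R.comp ((Q k).comp E)))
        (𝓝[≠] ((μ j : ℂ) * Complex.I)) (𝓝 (R.comp ((Q j).comp E)))) ∧
    (∀ c : ℝ, 0 < c → (∀ k, μ k ≠ c) →
      Tendsto
        (fun z : ℂ => ((c : ℂ) + Complex.I * z) •
          ∑' k : ℕ, ((μ k : ℂ) + Complex.I * z)⁻¹ • (R.comp ((Q k).comp E)))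
        (𝓝 ((c : ℂ) * Complex.I)) (𝓝 0)) := by
  refine ⟨fun j => ?_, fun c _ hc => ?_⟩
  · have h0 := (tendsto_smul_tsum_ite E R hidem hsa horth htop (μ j)).mono_left
      (nhdsWithin_le_nhds (s := {(μ j : ℂ) * Complex.I}ᶜ))
    have h1 := h0.const_add (R.comp ((Q j).comp E))
    rw [add_zero] at h1
    refine h1.congr' ?_
    filter_upwards [self_mem_nhdsWithin] with z hz
    have hne0 : (μ j : ℂ) + Complex.I * z ≠ 0 := by
      intro h
      apply hz
      have : z = (μ j : ℂ) * Complex.I - Complex.I * ((μ j : ℂ) + Complex.I * z) := by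
        linear_combination z * Complex.I_mul_I
      rw [h, mul_zero, sub_zero] at this
      exact this
    rw [(summable_smul_comp E R hidem hsa horth
      (tendsto_inv_add_I_mul_cofinite htop z)).tsum_eq_add_tsum_ite j, smul_add,
      smul_inv_smul₀ hne0]
    simp only [ite_smul, zero_smul, hmono.injective.eq_iff]
  · simpa only [if_neg (hc _)] using tendsto_smul_tsum_ite E R hidem hsa horth htop c
end

section
/- Let H₁, H₂ be complex Hilbert spaces and let two data sets be given: (H, E, R, (Q_k), (μ_k)) and (H̃, Ẽ, R̃, (Q̃_k), (ν_k)), each satisfying the Hilbert space setup below with target spaces H₁, H₂, and such that R ∘ Q_k ∘ E ≠ 0 and R̃ ∘ Q̃_k ∘ Ẽ ≠ 0 for every k. If ∑_{k=1}^∞ (μ_k + i z)^{−1} R ∘ Q_k ∘ E = ∑_{k=1}^∞ (ν_k + i z)^{−1} R̃ ∘ Q̃_k ∘ Ẽ for every z ∈ ℂ with z ∉ {i μ_k : k ≥ 1} ∪ {i ν_k : k ≥ 1}, then the pole data coincide: for every k there exists l with μ_k = ν_l and R ∘ Q_k ∘ E = R̃ ∘ Q̃_l ∘ Ẽ, and conversely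 for every l there exists k with ν_l = μ_k and R̃ ∘ Q̃_l ∘ Ẽ = R ∘ Q_k ∘ E. -/
open Filter Topology

section PoleData

/-- A sequence of vectors whose finite linear combinations are bounded by the supremum of their
coefficients, up to a constant. -/
def IsSupBounded {V : Type*} [NormedAddCommGroup V] [NormedSpace ℂ V] (A : ℕ → V) (M : ℝ) : Prop :=
  ∀ (s : Finset ℕ) (a : ℕ → ℂ) (C : ℝ), 0 ≤ C → (∀ k ∈ s, ‖a k‖ ≤ C) →
    ‖∑ k ∈ s, a k • A k‖ ≤ C * M

section Projections

variable {H : Type*} [NormedAddCommGroup H] [InnerProductSpace ℂ H] [CompleteSpace H]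
  {Q : ℕ → H →L[ℂ] H}

lemma inner_proj_proj (hsa : ∀ k, IsSelfAdjoint (Q k))
    (horth : ∀ k l, k ≠ l → (Q k).comp (Q l) = 0) {k l : ℕ} (hkl : k ≠ l) (x y : H) :
    inner ℂ (Q k x) (Q l y) = 0 := by
  have h := (hsa k).isSymmetric x (Q l y)
  have h0 : Q k (Q l y) = 0 := by simpa using DFunLike.congr_fun (horth k l hkl) y
  simp only [ContinuousLinearMap.coe_coe] at h
  rw [h, h0, inner_zero_right]

lemma norm_sq_sum_smul_proj (hsa : ∀ k, IsSelfAdjoint (Q k))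
    (horth : ∀ k l, k ≠ l → (Q k).comp (Q l) = 0) (s : Finset ℕ) (a : ℕ → ℂ) (x : H) :
    ‖∑ k ∈ s, a k • Q k x‖ ^ 2 = ∑ k ∈ s, ‖a k‖ ^ 2 * ‖Q k x‖ ^ 2 := by
  have key : inner ℂ (∑ k ∈ s, a k • Q k x) (∑ k ∈ s, a k • Q k x) =
      ∑ k ∈ s, inner ℂ (a k • Q k x) (a k • Q k x) := by
    rw [sum_inner]
    refine Finset.sum_congr rfl fun k hk => ?_
    rw [inner_sum]
    refine Finset.sum_eq_single_of_mem k hk fun l _ hl => ?_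
    rw [inner_smul_left, inner_smul_right, inner_proj_proj hsa horth hl.symm]
    simp
  simp only [inner_self_eq_norm_sq_to_K, norm_smul] at key
  simp only [← mul_pow]
  exact_mod_cast key

lemma sum_norm_sq_proj_le (hidem : ∀ k, (Q k).comp (Q k) = Q k)
    (hsa : ∀ k, IsSelfAdjoint (Q k)) (horth : ∀ k l, k ≠ l → (Q k).comp (Q l) = 0)
    (s : Finset ℕ) (x : H) : ∑ k ∈ s, ‖Q k x‖ ^ 2 ≤ ‖x‖ ^ 2 := by
  have h1 : ‖∑ k ∈ s, Q k x‖ ^ 2 = ∑ k ∈ s, ‖Q k x‖ ^ 2 := by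
    simpa using norm_sq_sum_smul_proj hsa horth s (fun _ => 1) x
  have h2 : inner ℂ x (∑ k ∈ s, Q k x) = ((∑ k ∈ s, ‖Q k x‖ ^ 2 : ℝ) : ℂ) := by
    rw [inner_sum, Complex.ofReal_sum]
    refine Finset.sum_congr rfl fun k _ => ?_
    have h := (hsa k).isSymmetric x (Q k x)
    have h0 : Q k (Q k x) = Q k x := DFunLike.congr_fun (hidem k) x
    simp only [ContinuousLinearMap.coe_coe] at h
    rw [h0, inner_self_eq_norm_sq_to_K] at h
    rw [← h]
    norm_cast
  have h3 := norm_inner_le_norm (𝕜 := ℂ) x (∑ k ∈ s, Q k x)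
  rw [h2, ← h1, Complex.norm_real, Real.norm_of_nonneg (by positivity)] at h3
  rw [← h1]
  have h4 : ‖∑ k ∈ s, Q k x‖ ≤ ‖x‖ := by
    by_contra! h
    nlinarith [norm_nonneg x, norm_nonneg (∑ k ∈ s, Q k x)]
  gcongr

lemma isSupBounded_comp_proj_comp {H₁ H₂ : Type*}
    [NormedAddCommGroup H₁] [NormedSpace ℂ H₁] [NormedAddCommGroup H₂] [NormedSpace ℂ H₂]
    (E : H₁ →L[ℂ] H) (R : H →L[ℂ] H₂) (hidem : ∀ k, (Q k).comp (Q k) = Q k)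
    (hsa : ∀ k, IsSelfAdjoint (Q k)) (horth : ∀ k l, k ≠ l → (Q k).comp (Q l) = 0) :
    IsSupBounded (fun k => R.comp ((Q k).comp E)) (‖R‖ * ‖E‖) := by
  intro s a C hC ha
  refine ContinuousLinearMap.opNorm_le_bound _ (by positivity) fun x => ?_
  have h1 : (∑ k ∈ s, a k • R.comp ((Q k).comp E)) x = R (∑ k ∈ s, a k • Q k (E x)) := by
    simp
  have h2 : ‖∑ k ∈ s, a k • Q k (E x)‖ ≤ C * ‖E x‖ := by
    refine le_of_sq_le_sq ?_ (by positivity)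
    rw [norm_sq_sum_smul_proj hsa horth, mul_pow]
    calc ∑ k ∈ s, ‖a k‖ ^ 2 * ‖Q k (E x)‖ ^ 2 ≤ ∑ k ∈ s, C ^ 2 * ‖Q k (E x)‖ ^ 2 := by
          gcongr with k hk
          exact ha k hk
      _ = C ^ 2 * ∑ k ∈ s, ‖Q k (E x)‖ ^ 2 := by rw [Finset.mul_sum]
      _ ≤ _ := by
          gcongr
          exact sum_norm_sq_proj_le hidem hsa horth s (E x)
  rw [h1]
  calc _ ≤ ‖R‖ * ‖∑ k ∈ s, a k • Q k (E x)‖ := R.le_opNorm _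
    _ ≤ ‖R‖ * (C * (‖E‖ * ‖x‖)) := by
        gcongr
        exact h2.trans (by gcongr; exact E.le_opNorm x)
    _ = _ := by ring

end Projections

section Residues

variable {V : Type*} [NormedAddCommGroup V] [NormedSpace ℂ V]
  {A B : ℕ → V} {M N : ℝ} {μ ν : ℕ → ℝ}

lemma IsSupBounded.summable [CompleteSpace V] (hA : IsSupBounded A M) {a : ℕ → ℂ}
    (ha : Tendsto a atTop (𝓝 0)) : Summable fun k => a k • A k := by
  rw [summable_iff_vanishing_norm]
  intro ε hε
  have hc : 0 < ε / (|M| + 1) := by positivity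
  obtain ⟨n, hn⟩ := Metric.tendsto_atTop.1 ha _ hc
  refine ⟨Finset.range n, fun t ht => ?_⟩
  have h := hA t a _ hc.le fun k hk => by
    have hk' : n ≤ k := by
      by_contra! hlt
      exact Finset.disjoint_left.1 ht hk (Finset.mem_range.2 hlt)
    simpa using (hn k hk').le
  refine h.trans_lt ?_
  calc ε / (|M| + 1) * M ≤ ε / (|M| + 1) * |M| := by gcongr; exact le_abs_self M
    _ < ε / (|M| + 1) * (|M| + 1) := by gcongr; linarith
    _ = ε := by field_simp

lemma IsSupBounded.norm_tsum_le (hA : IsSupBounded A M) {a : ℕ → ℂ} {C : ℝ} (hC : 0 ≤ C)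
    (ha : ∀ k, ‖a k‖ ≤ C) (hs : Summable fun k => a k • A k) :
    ‖∑' k, a k • A k‖ ≤ C * M :=
  le_of_tendsto hs.hasSum.norm (.of_forall fun s => hA s a C hC fun k _ => ha k)

lemma exists_gap_of_tendsto_atTop (htop : Tendsto μ atTop atTop) (x : ℝ) :
    ∃ d > 0, ∀ k, μ k ≠ x → d ≤ |μ k - x| := by
  obtain ⟨n, hn⟩ := eventually_atTop.1 (htop.eventually_ge_atTop (x + 1))
  have hfin : (μ '' {k | k < n ∧ μ k ≠ x}).Finite :=
    ((Set.finite_lt_nat n).subset fun k hk => hk.1).image μ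
  have hx : x ∈ (μ '' {k | k < n ∧ μ k ≠ x})ᶜ := by
    rintro ⟨k, hk, h⟩
    exact hk.2 h
  obtain ⟨ε, hε, hball⟩ := Metric.isOpen_iff.1 hfin.isClosed.isOpen_compl x hx
  refine ⟨min ε 1, by positivity, fun k hk => ?_⟩
  by_cases hkn : k < n
  · by_contra! h
    have hmem : μ k ∈ Metric.ball x ε := by
      rw [Metric.mem_ball, Real.dist_eq]
      exact h.trans_le (min_le_left _ _)
    exact hball hmem ⟨k, ⟨hkn, hk⟩, rfl⟩
  · have := hn k (not_lt.1 hkn)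
    exact (min_le_right _ _).trans ((by linarith : 1 ≤ μ k - x).trans (le_abs_self _))

lemma eventually_ne_poles (htop : Tendsto μ atTop atTop) (x : ℝ) :
    ∀ᶠ w : ℂ in 𝓝[≠] (x : ℂ), ∀ k, w ≠ μ k := by
  obtain ⟨d, hd, hgap⟩ := exists_gap_of_tendsto_atTop htop x
  filter_upwards [self_mem_nhdsWithin, mem_nhdsWithin_of_mem_nhds (Metric.ball_mem_nhds _ hd)]
    with w hw hwd k rfl
  have hne : μ k ≠ x := fun h => hw (by simp [h])
  have := hgap k hne
  rw [Metric.mem_ball, Complex.dist_eq, ← Complex.ofReal_sub, Complex.norm_real,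
    Real.norm_eq_abs] at hwd
  linarith

lemma tendsto_inv_sub_const (htop : Tendsto μ atTop atTop) (w : ℂ) :
    Tendsto (fun k => ((μ k : ℂ) - w)⁻¹) atTop (𝓝 0) := by
  refine tendsto_inv₀_cobounded.comp (tendsto_norm_atTop_iff_cobounded.1 ?_)
  refine tendsto_atTop_mono (fun k => ?_) (tendsto_atTop_add_const_right _ (-‖w‖) htop)
  have h1 := norm_sub_norm_le (μ k : ℂ) w
  have h2 := le_abs_self (μ k)
  rw [Complex.norm_real, Real.norm_eq_abs] at h1
  linarith

lemma IsSupBounded.tendsto_residue [CompleteSpace V] (hA : IsSupBounded A M)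
    (htop : Tendsto μ atTop atTop) (x : ℝ) :
    Tendsto (fun w : ℂ => ((x : ℂ) - w) • ∑' k, ((μ k : ℂ) - w)⁻¹ • A k) (𝓝[≠] (x : ℂ))
      (𝓝 (∑' k, (if μ k = x then (1 : ℂ) else 0) • A k)) := by
  obtain ⟨d, hd, hgap⟩ := exists_gap_of_tendsto_atTop htop x
  have hind : Summable fun k => (if μ k = x then (1 : ℂ) else 0) • A k := by
    refine hA.summable (tendsto_const_nhds.congr' ?_)
    filter_upwards [htop.eventually_gt_atTop x] with k hk
    rw [if_neg hk.ne']
  have hlim : Tendsto (fun w : ℂ => ‖w - x‖ * (2 / d) * M) (𝓝[≠] (x : ℂ)) (𝓝 0) := by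
    refine Tendsto.mono_left ?_ nhdsWithin_le_nhds
    have : Continuous fun w : ℂ => ‖w - x‖ * (2 / d) * M := by fun_prop
    simpa using this.tendsto (x : ℂ)
  refine tendsto_iff_norm_sub_tendsto_zero.2 (squeeze_zero' (.of_forall fun _ => norm_nonneg _)
    ?_ hlim)
  filter_upwards [self_mem_nhdsWithin,
    mem_nhdsWithin_of_mem_nhds (Metric.ball_mem_nhds _ (half_pos hd))] with w hw hwd
  rw [Metric.mem_ball, Complex.dist_eq] at hwd
  have hw' : (x : ℂ) - w ≠ 0 := sub_ne_zero.2 (Ne.symm hw)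
  have hsum := hA.summable (tendsto_inv_sub_const htop w)
  have hsum' := hsum.const_smul ((x : ℂ) - w)
  have hdiff := hsum'.sub hind
  rw [← hsum.tsum_const_smul, ← hsum'.tsum_sub hind]
  simp only [smul_smul, ← sub_smul] at hdiff ⊢
  refine hA.norm_tsum_le (by positivity) (fun k => ?_) hdiff
  by_cases hk : μ k = x
  · rw [if_pos hk, hk, mul_inv_cancel₀ hw', sub_self, norm_zero]
    positivity
  · rw [if_neg hk, sub_zero, norm_mul, norm_inv, norm_sub_rev]
    have h1 := hgap k hk
    have h2 := norm_sub_le_norm_sub_add_norm_sub (μ k : ℂ) w x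
    rw [← Complex.ofReal_sub, Complex.norm_real, Real.norm_eq_abs] at h2
    have h3 : d / 2 ≤ ‖(μ k : ℂ) - w‖ := by linarith
    gcongr
    rw [← inv_div]
    gcongr

lemma tsum_ite_eq_of_injective (hμ : Function.Injective μ) (A : ℕ → V) (k : ℕ) :
    ∑' l, (if μ l = μ k then (1 : ℂ) else 0) • A l = A k := by
  rw [tsum_eq_single k fun l hl => by rw [if_neg (hμ.ne hl), zero_smul], if_pos rfl, one_smul]

lemma exists_pole_eq [CompleteSpace V] (hA : IsSupBounded A M) (hB : IsSupBounded B N)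
    (hμ : Function.Injective μ) (hμtop : Tendsto μ atTop atTop)
    (hν : Function.Injective ν) (hνtop : Tendsto ν atTop atTop) (hA0 : ∀ k, A k ≠ 0)
    (heq : ∀ w : ℂ, (∀ k, w ≠ μ k) → (∀ k, w ≠ ν k) →
      ∑' k, ((μ k : ℂ) - w)⁻¹ • A k = ∑' k, ((ν k : ℂ) - w)⁻¹ • B k) (k : ℕ) :
    ∃ l, μ k = ν l ∧ A k = B l := by
  have hres : A k = ∑' l, (if ν l = μ k then (1 : ℂ) else 0) • B l := by
    rw [← tsum_ite_eq_of_injective hμ A k]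
    refine tendsto_nhds_unique (hA.tendsto_residue hμtop (μ k))
      ((hB.tendsto_residue hνtop (μ k)).congr' ?_)
    filter_upwards [eventually_ne_poles hμtop (μ k), eventually_ne_poles hνtop (μ k)]
      with w h1 h2
    rw [heq w h1 h2]
  by_cases h : ∃ l, μ k = ν l
  · obtain ⟨l, hl⟩ := h
    exact ⟨l, hl, by rw [hres, hl, tsum_ite_eq_of_injective hν B l]⟩
  · push Not at h
    refine absurd ?_ (hA0 k)
    rw [hres]
    simp [fun l => (h l).symm]

end Residues

end PoleData

/-- If two families of data, each satisfying the Hilbert space setup (with the same source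
and target spaces `H₁`, `H₂`) and having nonzero composite operators `R ∘ Q_k ∘ E`, produce
the same meromorphic operator-valued function
`∑_k (μ_k + iz)⁻¹ R ∘ Q_k ∘ E = ∑_k (ν_k + iz)⁻¹ R̃ ∘ Q̃_k ∘ Ẽ` away from the poles,
then the pole data coincide. -/
theorem operator_series_pole_data_determination {H H' H₁ H₂ : Type*}
    [NormedAddCommGroup H] [InnerProductSpace ℂ H] [CompleteSpace H]
    [NormedAddCommGroup H'] [InnerProductSpace ℂ H'] [CompleteSpace H']
    [NormedAddCommGroup H₁] [InnerProductSpace ℂ H₁] [CompleteSpace H₁]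
    [NormedAddCommGroup H₂] [InnerProductSpace ℂ H₂] [CompleteSpace H₂]
    (E : H₁ →L[ℂ] H) (R : H →L[ℂ] H₂) (Q : ℕ → H →L[ℂ] H)
    (hidem : ∀ k, (Q k).comp (Q k) = Q k) (hsa : ∀ k, IsSelfAdjoint (Q k))
    (hne : ∀ k, Q k ≠ 0) (horth : ∀ k l, k ≠ l → (Q k).comp (Q l) = 0)
    (μ : ℕ → ℝ) (hpos : ∀ k, 0 < μ k) (hmono : StrictMono μ)
    (htop : Tendsto μ atTop atTop)
    (E' : H₁ →L[ℂ] H') (R' : H' →L[ℂ] H₂) (Q' : ℕ → H' →L[ℂ] H')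
    (hidem' : ∀ k, (Q' k).comp (Q' k) = Q' k) (hsa' : ∀ k, IsSelfAdjoint (Q' k))
    (hne' : ∀ k, Q' k ≠ 0) (horth' : ∀ k l, k ≠ l → (Q' k).comp (Q' l) = 0)
    (ν : ℕ → ℝ) (hpos' : ∀ k, 0 < ν k) (hmono' : StrictMono ν)
    (htop' : Tendsto ν atTop atTop)
    (hRQE : ∀ k, R.comp ((Q k).comp E) ≠ 0)
    (hRQE' : ∀ k, R'.comp ((Q' k).comp E') ≠ 0)
    (heq : ∀ z : ℂ, (∀ k, z ≠ (μ k : ℂ) * Complex.I) → (∀ k, z ≠ (ν k : ℂ) * Complex.I) →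
      (∑' k : ℕ, ((μ k : ℂ) + Complex.I * z)⁻¹ • (R.comp ((Q k).comp E))) =
        ∑' k : ℕ, ((ν k : ℂ) + Complex.I * z)⁻¹ • (R'.comp ((Q' k).comp E'))) :
    (∀ k, ∃ l, μ k = ν l ∧ R.comp ((Q k).comp E) = R'.comp ((Q' l).comp E')) ∧
    (∀ l, ∃ k, ν l = μ k ∧ R'.comp ((Q' l).comp E') = R.comp ((Q k).comp E)) := by
  have hA := isSupBounded_comp_proj_comp E R hidem hsa horth
  have hB := isSupBounded_comp_proj_comp E' R' hidem' hsa' horth'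
  have heq' : ∀ w : ℂ, (∀ k, w ≠ μ k) → (∀ k, w ≠ ν k) →
      ∑' k, ((μ k : ℂ) - w)⁻¹ • R.comp ((Q k).comp E) =
        ∑' k, ((ν k : ℂ) - w)⁻¹ • R'.comp ((Q' k).comp E') := by
    intro w h1 h2
    have h := heq (w * Complex.I) (fun k hk => h1 k (mul_right_cancel₀ Complex.I_ne_zero hk))
      (fun k hk => h2 k (mul_right_cancel₀ Complex.I_ne_zero hk))
    have hI : Complex.I * (w * Complex.I) = -w := by
      rw [mul_left_comm, Complex.I_mul_I, mul_neg_one]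
    simpa only [hI, ← sub_eq_add_neg] using h
  exact ⟨exists_pole_eq hA hB hmono.injective htop hmono'.injective htop' hRQE heq',
    exists_pole_eq hB hA hmono'.injective htop' hmono.injective htop hRQE'
      fun w h1 h2 => (heq' w h2 h1).symm⟩
end

section
/- Let (λ_k)_{k≥1} and (λ̃_k)_{k≥1} be nondecreasing sequences of positive real numbers tending to ∞, and define the counting functions N(λ) = #{k : λ_k ≤ λ} and Ñ(λ) = #{k : λ̃_k ≤ λ} (finite for each λ). Suppose there exist a real number p > 0 and constants C, C̃ > 0 such that N(λ)/λ^p → C and Ñ(λ)/λ^p → C̃ as λ → ∞. If β, β̃ ∈ (0, 1) satisfy λ_k^β = λ̃_k^{β̃} for every k, then β = β̃ (and consequently λ_k = λ̃_k for every k). -/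
open Filter Topology

theorem exponent_eq_zero_of_tendsto_rpow {s L : ℝ} (hL : L ≠ 0)
    (h : Tendsto (fun x : ℝ => x ^ s) atTop (𝓝 L)) : s = 0 := by
  rcases lt_trichotomy s 0 with hs | hs | hs
  · have h0 := tendsto_rpow_neg_atTop (neg_pos.mpr hs)
    rw [neg_neg] at h0
    exact absurd (tendsto_nhds_unique h h0) hL
  · exact hs
  · exact absurd h (not_tendsto_nhds_of_tendsto_atTop (tendsto_rpow_atTop hs) L)

/-- Rescaling the argument of a function of growth order `p` by the power `r` multiplies its
growth order by `r`. -/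
theorem growth_exponent_comp_rpow {N : ℝ → ℝ} {p q r C C' : ℝ} (hr : 0 < r)
    (hC : C ≠ 0) (hC' : C' ≠ 0)
    (hN : Tendsto (fun x => N x / x ^ p) atTop (𝓝 C))
    (hN' : Tendsto (fun x => N (x ^ r) / x ^ q) atTop (𝓝 C')) : r * p = q := by
  have hcomp := hN.comp (tendsto_rpow_atTop hr)
  have hdiv := hN'.div hcomp hC
  refine sub_eq_zero.mp (exponent_eq_zero_of_tendsto_rpow (div_ne_zero hC' hC) (hdiv.congr' ?_))
  filter_upwards [eventually_gt_atTop 0, hcomp.eventually_ne hC] with x hx hne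
  have hNx : N (x ^ r) ≠ 0 := fun h0 => hne (by simp [h0])
  have hxq := (Real.rpow_pos_of_pos hx q).ne'
  have hxrp := (Real.rpow_pos_of_pos hx (r * p)).ne'
  simp only [Pi.div_apply, Function.comp_apply]
  rw [← Real.rpow_mul hx.le, Real.rpow_sub hx]
  field_simp

/-- Abstract Weyl-law argument: if two nondecreasing positive sequences tending to `∞` have
eigenvalue counting functions with the same power-law growth `λ^p` (with positive limiting
constants), and their fractional powers agree termwise, `λ_k^β = λ̃_k^β̃` with
`β, β̃ ∈ (0,1)`, then `β = β̃` and the sequences are equal. -/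
theorem weyl_law_exponent_determination (lam lamt : ℕ → ℝ)
    (hmono : Monotone lam) (hmono' : Monotone lamt)
    (hposseq : ∀ k, 0 < lam k) (hposseq' : ∀ k, 0 < lamt k)
    (htop : Tendsto lam atTop atTop) (htop' : Tendsto lamt atTop atTop)
    (p C C' : ℝ) (hp : 0 < p) (hC : 0 < C) (hC' : 0 < C')
    (hN : Tendsto (fun x : ℝ => (Nat.card {k : ℕ | lam k ≤ x} : ℝ) / x ^ p)
      atTop (𝓝 C))
    (hN' : Tendsto (fun x : ℝ => (Nat.card {k : ℕ | lamt k ≤ x} : ℝ) / x ^ p)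
      atTop (𝓝 C'))
    (β β' : ℝ) (hβ0 : 0 < β) (hβ1 : β < 1) (hβ0' : 0 < β') (hβ1' : β' < 1)
    (heq : ∀ k, lam k ^ β = lamt k ^ β') :
    β = β' ∧ ∀ k, lam k = lamt k := by
  have hlam (k : ℕ) : lam k = lamt k ^ (β' / β) := by
    rw [div_eq_mul_inv, Real.rpow_mul (hposseq' k).le, ← heq k,
      Real.rpow_rpow_inv (hposseq k).le hβ0.ne']
  have hr : 0 < β' / β := div_pos hβ0' hβ0
  have hcount : (fun x : ℝ => (Nat.card {k : ℕ | lamt k ≤ x} : ℝ) / x ^ p) =ᶠ[atTop]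
      fun x : ℝ => (Nat.card {k : ℕ | lam k ≤ x ^ (β' / β)} : ℝ) / x ^ p := by
    filter_upwards [eventually_ge_atTop 0] with x hx
    simp only [hlam, Real.rpow_le_rpow_iff (hposseq' _).le hx hr]
  have hmul : β' / β * p = p :=
    growth_exponent_comp_rpow (N := fun x => (Nat.card {k : ℕ | lam k ≤ x} : ℝ)) hr hC.ne' hC'.ne'
      hN (hN'.congr' hcount)
  have hratio : β' / β = 1 := (mul_eq_right₀ hp.ne').mp hmul
  refine ⟨((div_eq_one_iff_eq hβ0.ne').mp hratio).symm, fun k => ?_⟩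
  rw [hlam k, hratio, Real.rpow_one]
end

section
/- Let 0 < α < 1. There exists a nonzero constant C_α ∈ ℂ depending only on α such that for every λ > 0 the function I_λ(t) := ∫_0^{t/3} E_{α,1}(i λ (t−τ)^α) dτ − ∫_{t/3}^{2t/3} E_{α,1}(i λ (t−τ)^α) dτ satisfies I_λ(t) = C_α λ^{−1} t^{1−α} + O(t^{1−2α}) as t → ∞; that is, there exist constants C′ > 0 and T > 0 (possibly depending on λ) with |I_λ(t) − C_α λ^{−1} t^{1−α}| ≤ C′ t^{1−2α} for all t ≥ T. -/
section

open Complex MeasureTheory Set Filter Topology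

/-- The integral of `F` along the Hankel-type contour which, in logarithmic coordinates, comes in
from `+∞` along `Im w = -φ`, climbs the segment `Re w = a`, and returns along `Im w = φ`. -/
noncomputable def hankelIntegral (φ a : ℝ) (F : ℂ → ℂ) : ℂ :=
  I * (∫ θ in (-φ)..φ, F (a + θ * I)) + (∫ ρ in Ioi a, F (ρ + φ * I)) -
    ∫ ρ in Ioi a, F (ρ + (-φ : ℝ) * I)

/-- The integrand of Hankel's integral for `1 / Γ (1 - p)` in logarithmic coordinates. -/
noncomputable def hankelKernel (p : ℝ) (w : ℂ) : ℂ := exp (exp w) * exp (p * w)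

lemma differentiable_hankelKernel (p : ℝ) : Differentiable ℂ (hankelKernel p) := by
  unfold hankelKernel; fun_prop

lemma norm_hankelKernel (p x y : ℝ) :
    ‖hankelKernel p (x + y * I)‖ = Real.exp (Real.exp x * Real.cos y) * Real.exp (p * x) := by
  simp [hankelKernel, norm_exp, exp_re]

lemma tendsto_exp_exp_mul_exp {c : ℝ} (hc : c < 0) (p : ℝ) :
    Tendsto (fun x : ℝ => Real.exp (Real.exp x * c) * Real.exp (p * x)) atTop (𝓝 0) := by
  refine ((tendsto_rpow_mul_exp_neg_mul_atTop_nhds_zero p (-c) (by linarith)).comp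
    Real.tendsto_exp_atTop).congr fun x => ?_
  simp only [Function.comp_apply, neg_neg, ← Real.exp_mul]
  rw [mul_comm, mul_comm c, mul_comm x]

lemma integrableOn_exp_exp_mul_exp {c : ℝ} (hc : c < 0) (p a : ℝ) :
    IntegrableOn (fun x : ℝ => Real.exp (Real.exp x * c) * Real.exp (p * x)) (Ioi a) := by
  refine integrable_of_isBigO_exp_neg one_pos (by fun_prop) ?_
  refine (Asymptotics.isLittleO_of_tendsto (fun x hx => absurd hx (Real.exp_ne_zero _)) ?_).isBigO
  refine (tendsto_exp_exp_mul_exp hc (p + 1)).congr fun x => ?_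
  rw [eq_div_iff (Real.exp_ne_zero _), mul_assoc, ← Real.exp_add]
  ring_nf

lemma integrableOn_hankelKernel {φ : ℝ} (hφ : Real.cos φ < 0) (p a : ℝ) :
    IntegrableOn (fun ρ : ℝ => hankelKernel p (ρ + φ * I)) (Ioi a) := by
  refine (integrableOn_exp_exp_mul_exp hφ p a).mono' ?_ (ae_of_all _ fun x => ?_)
  · have := (differentiable_hankelKernel p).continuous
    exact Continuous.aestronglyMeasurable (by fun_prop)
  · rw [norm_hankelKernel]

/-- The Hankel-type integral does not depend on the abscissa of the vertical segment. -/
lemma hankelIntegral_eq_of_differentiableOn {φ a b : ℝ} (hφ : 0 ≤ φ) {F : ℂ → ℂ}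
    (hF : DifferentiableOn ℂ F (univ ×ℂ Icc (-φ) φ))
    (ha : IntegrableOn (fun ρ : ℝ => F (ρ + φ * I)) (Ioi a))
    (ha' : IntegrableOn (fun ρ : ℝ => F (ρ + (-φ : ℝ) * I)) (Ioi a))
    (hb : IntegrableOn (fun ρ : ℝ => F (ρ + φ * I)) (Ioi b))
    (hb' : IntegrableOn (fun ρ : ℝ => F (ρ + (-φ : ℝ) * I)) (Ioi b)) :
    hankelIntegral φ a F = hankelIntegral φ b F := by
  have h := integral_boundary_rect_eq_zero_of_differentiableOn F (a + (-φ : ℝ) * I) (b + φ * I)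
    (hF.mono ?_)
  · have e1 := intervalIntegral.integral_Ioi_sub_Ioi' ha hb
    have e2 := intervalIntegral.integral_Ioi_sub_Ioi' ha' hb'
    simp only [add_re, add_im, mul_re, mul_im, ofReal_re, ofReal_im, I_re, I_im, mul_zero, mul_one,
      sub_zero, add_zero, zero_add, smul_eq_mul] at h
    rw [← e1, ← e2] at h
    unfold hankelIntegral
    linear_combination -h
  · intro w hw
    rw [mem_reProdIm] at hw ⊢
    refine ⟨mem_univ _, ?_⟩
    have := hw.2
    simpa [uIcc_of_le (by linarith : -φ ≤ φ)] using this

/-- Moving a horizontal half-line upwards. -/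
lemma integral_Ioi_sub_integral_Ioi_eq {φ ψ a : ℝ} (h : φ ≤ ψ) {F : ℂ → ℂ}
    (hF : Differentiable ℂ F)
    (h1 : IntegrableOn (fun ρ : ℝ => F (ρ + φ * I)) (Ioi a))
    (h2 : IntegrableOn (fun ρ : ℝ => F (ρ + ψ * I)) (Ioi a))
    {g : ℝ → ℝ} (hg : Tendsto g atTop (𝓝 0))
    (hFg : ∀ x : ℝ, ∀ y ∈ Icc φ ψ, ‖F (x + y * I)‖ ≤ g x) :
    (∫ ρ in Ioi a, F (ρ + φ * I)) - ∫ ρ in Ioi a, F (ρ + ψ * I) =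
      I * ∫ θ in φ..ψ, F (a + θ * I) := by
  have hr : ∀ b : ℝ, ((∫ x in a..b, F (x + φ * I)) - ∫ x in a..b, F (x + ψ * I)) +
      I * (∫ y in φ..ψ, F (b + y * I)) - I * ∫ y in φ..ψ, F (a + y * I) = 0 := by
    intro b
    simpa using integral_boundary_rect_eq_zero_of_differentiableOn F (a + φ * I) (b + ψ * I)
      hF.differentiableOn
  have hv : Tendsto (fun b : ℝ => ∫ y in φ..ψ, F (b + y * I)) atTop (𝓝 0) := by
    refine squeeze_zero_norm (a := fun b => g b * |ψ - φ|) (fun b => ?_)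
      (by simpa using hg.mul_const |ψ - φ|)
    refine intervalIntegral.norm_integral_le_of_norm_le_const fun y hy => hFg b y ?_
    rw [uIoc_of_le h] at hy
    exact ⟨hy.1.le, hy.2⟩
  have t := (((intervalIntegral_tendsto_integral_Ioi a h1 tendsto_id).sub
    (intervalIntegral_tendsto_integral_Ioi a h2 tendsto_id)).add (hv.const_mul I)).sub_const
      (I * ∫ y in φ..ψ, F (a + y * I))
  have := tendsto_nhds_unique t (tendsto_const_nhds.congr fun b => (hr b).symm)
  linear_combination this

lemma cos_le_of_mem_Icc {φ y : ℝ} (h0 : 0 ≤ φ) (hy : y ∈ Icc φ Real.pi) :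
    Real.cos y ≤ Real.cos φ := Real.cos_le_cos_of_nonneg_of_le_pi h0 hy.2 hy.1

lemma hankelIntegral_hankelKernel_eq_pi {φ : ℝ} (h0 : 0 ≤ φ) (hπ : φ ≤ Real.pi)
    (hφ : Real.cos φ < 0) (p : ℝ) :
    hankelIntegral φ 0 (hankelKernel p) = hankelIntegral Real.pi 0 (hankelKernel p) := by
  have hd := differentiable_hankelKernel p
  have hc := hd.continuous
  have hφ' : Real.cos (-φ) < 0 := by rwa [Real.cos_neg]
  have hp : Real.cos Real.pi < 0 := by simp
  have hp' : Real.cos (-Real.pi) < 0 := by simp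
  have e1 := integral_Ioi_sub_integral_Ioi_eq (a := 0) hπ hd (integrableOn_hankelKernel hφ p 0)
    (integrableOn_hankelKernel hp p 0) (tendsto_exp_exp_mul_exp hφ p) (fun x y hy => by
      rw [norm_hankelKernel]
      have := cos_le_of_mem_Icc h0 hy
      gcongr)
  have e2 := integral_Ioi_sub_integral_Ioi_eq (a := 0) (neg_le_neg hπ) hd
    (integrableOn_hankelKernel hp' p 0)
    (integrableOn_hankelKernel hφ' p 0) (tendsto_exp_exp_mul_exp hφ p) (fun x y hy => by
      rw [norm_hankelKernel]
      have : Real.cos y ≤ Real.cos φ := by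
        rw [← Real.cos_neg y]
        exact cos_le_of_mem_Icc h0 ⟨by linarith [hy.2], by linarith [hy.1]⟩
      gcongr)
  have hi : ∀ u v : ℝ, IntervalIntegrable
      (fun θ : ℝ => hankelKernel p ((0 : ℝ) + θ * I)) volume u v := fun u v =>
    Continuous.intervalIntegrable (by fun_prop) _ _
  have e3 := intervalIntegral.integral_add_adjacent_intervals
    (hi (-Real.pi) (-φ)) (hi (-φ) φ)
  have e4 := intervalIntegral.integral_add_adjacent_intervals
    (hi (-Real.pi) φ) (hi φ Real.pi)
  unfold hankelIntegral
  linear_combination e1 + e2 + I * (e3 + e4)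

lemma hankelIntegral_hankelKernel_add_one (p : ℝ) :
    hankelIntegral Real.pi 0 (hankelKernel (p + 1)) =
      -p * hankelIntegral Real.pi 0 (hankelKernel p) := by
  have hd := differentiable_hankelKernel p
  have hc : ∀ q, Continuous (hankelKernel q) := fun q => (differentiable_hankelKernel q).continuous
  have hp : Real.cos Real.pi < 0 := by simp
  have hp' : Real.cos (-Real.pi) < 0 := by simp
  have hder : ∀ w, HasDerivAt (hankelKernel p) (hankelKernel (p + 1) w + p * hankelKernel p w) w := by
    intro w
    have h1 := (Complex.hasDerivAt_exp w).cexp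
    have h2 := (((hasDerivAt_id w).const_mul (p : ℂ))).cexp
    refine (h1.mul h2).congr_deriv ?_
    simp only [hankelKernel, id, ofReal_add, ofReal_one, add_mul, one_mul, Complex.exp_add]
    ring
  have hhor : ∀ y : ℝ, Real.cos y < 0 →
      (∫ ρ in Ioi (0 : ℝ), hankelKernel (p + 1) (ρ + y * I)) +
        p * (∫ ρ in Ioi (0 : ℝ), hankelKernel p (ρ + y * I)) =
          - hankelKernel p ((0 : ℝ) + y * I) := by
    intro y hy
    have i1 := integrableOn_hankelKernel hy (p + 1) 0
    have i2 := (integrableOn_hankelKernel hy p 0).const_mul (p : ℂ)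
    rw [← integral_const_mul, ← integral_add i1 i2,
      integral_Ioi_of_hasDerivAt_of_tendsto (f := fun ρ : ℝ => hankelKernel p (ρ + y * I))
      (f' := fun ρ : ℝ => hankelKernel (p + 1) (ρ + y * I) + p * hankelKernel p (ρ + y * I)) (m := 0)
      (by have := hc p; exact Continuous.continuousWithinAt (by fun_prop)) ?_ (i1.add i2) ?_]
    · simp
    · intro x _
      simpa [Function.comp_def] using HasDerivAt.comp x (hder (x + y * I)) (HasDerivAt.add_const _ ofRealCLM.hasDerivAt)
    · rw [tendsto_zero_iff_norm_tendsto_zero]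
      simpa only [norm_hankelKernel] using tendsto_exp_exp_mul_exp hy p
  have hver : I * (∫ θ in (-Real.pi)..Real.pi, hankelKernel (p + 1) ((0 : ℝ) + θ * I)) +
      p * (I * ∫ θ in (-Real.pi)..Real.pi, hankelKernel p ((0 : ℝ) + θ * I)) =
      hankelKernel p ((0 : ℝ) + Real.pi * I) - hankelKernel p ((0 : ℝ) + (-Real.pi : ℝ) * I) := by
    have hi : ∀ q : ℝ, IntervalIntegrable
        (fun θ : ℝ => hankelKernel q ((0 : ℝ) + θ * I)) volume (-Real.pi) Real.pi := fun q => by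
      have := hc q
      exact Continuous.intervalIntegrable (by fun_prop) _ _
    have ft := intervalIntegral.integral_eq_sub_of_hasDerivAt (a := -Real.pi) (b := Real.pi)
      (f := fun θ : ℝ => hankelKernel p ((0 : ℝ) + θ * I))
      (f' := fun θ : ℝ => I * hankelKernel (p + 1) ((0 : ℝ) + θ * I) +
        p * (I * hankelKernel p ((0 : ℝ) + θ * I))) (fun θ _ => ?_)
      (((hi _).const_mul _).add (((hi _).const_mul _).const_mul _))
    · rw [intervalIntegral.integral_add ((hi _).const_mul _) (((hi _).const_mul _).const_mul _)] at ft
      simpa only [intervalIntegral.integral_const_mul] using ft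
    · have hl : HasDerivAt (fun θ : ℝ => ((0 : ℝ) : ℂ) + θ * I) I θ := by
        simpa using (HasDerivAt.mul_const ofRealCLM.hasDerivAt I).const_add ((0 : ℝ) : ℂ)
      refine (HasDerivAt.comp θ (hder ((0 : ℝ) + θ * I)) hl).congr_deriv ?_
      ring
  have e1 := hhor _ hp
  have e2 := hhor _ hp'
  unfold hankelIntegral
  linear_combination e1 - e2 + hver

lemma integrable_exp_neg_exp_mul_exp {p : ℝ} (hp : 0 < p) :
    Integrable (fun x : ℝ => Real.exp (Real.exp x * (-1)) * Real.exp (p * x)) := by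
  rw [← integrableOn_univ, ← Iic_union_Ioi (a := (0 : ℝ))]
  refine IntegrableOn.union ?_ (integrableOn_exp_exp_mul_exp (by norm_num) p 0)
  refine (integrableOn_exp_mul_Iic hp 0).mono' (Continuous.aestronglyMeasurable (by fun_prop))
    (ae_of_all _ fun x => ?_)
  rw [Real.norm_of_nonneg (by positivity)]
  have : Real.exp (Real.exp x * (-1)) ≤ 1 := Real.exp_le_one_iff.2 (by nlinarith [Real.exp_pos x])
  nlinarith [Real.exp_pos (p * x)]

lemma integral_exp_neg_exp_mul_exp {p : ℝ} (hp : 0 < p) :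
    ∫ x : ℝ, Real.exp (Real.exp x * (-1)) * Real.exp (p * x) = Real.Gamma p := by
  have h := integral_image_eq_integral_abs_deriv_smul (s := univ) (f := Real.exp) (f' := Real.exp)
    MeasurableSet.univ (fun x _ => (Real.hasDerivAt_exp x).hasDerivWithinAt)
    Real.exp_injective.injOn (fun x => Real.exp (-x) * x ^ (p - 1))
  rw [image_univ, Real.range_exp, ← Real.Gamma_eq_integral hp, setIntegral_univ] at h
  rw [h]
  congr 1 with x
  rw [abs_of_pos (Real.exp_pos x), smul_eq_mul, ← Real.exp_mul, mul_neg_one,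
    show p * x = x + x * (p - 1) by ring, Real.exp_add]
  ring

lemma hankelKernel_add_pi (p x : ℝ) : hankelKernel p (x + Real.pi * I) =
    ((Real.exp (Real.exp x * (-1)) * Real.exp (p * x) : ℝ) : ℂ) * exp (p * Real.pi * I) := by
  simp only [hankelKernel, Complex.exp_add, exp_pi_mul_I, mul_add]
  push_cast
  ring_nf

lemma hankelKernel_sub_pi (p x : ℝ) : hankelKernel p (x + (-Real.pi : ℝ) * I) =
    ((Real.exp (Real.exp x * (-1)) * Real.exp (p * x) : ℝ) : ℂ) * exp (-(p * Real.pi * I)) := by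
  have : exp (((-Real.pi : ℝ) : ℂ) * I) = -1 := by
    rw [ofReal_neg, neg_mul, Complex.exp_neg, exp_pi_mul_I]; norm_num
  simp only [hankelKernel, Complex.exp_add, this, mul_add]
  push_cast
  ring_nf

lemma hankelIntegral_pi_hankelKernel_eq (p a : ℝ) :
    hankelIntegral Real.pi a (hankelKernel p) = hankelIntegral Real.pi 0 (hankelKernel p) := by
  have hp : Real.cos Real.pi < 0 := by simp
  have hp' : Real.cos (-Real.pi) < 0 := by simp
  exact hankelIntegral_eq_of_differentiableOn Real.pi_pos.le
    (differentiable_hankelKernel p).differentiableOn (integrableOn_hankelKernel hp p a)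
    (integrableOn_hankelKernel hp' p a) (integrableOn_hankelKernel hp p 0)
    (integrableOn_hankelKernel hp' p 0)

lemma tendsto_integral_hankelKernel_atBot {p : ℝ} (hp : 0 ≤ p) :
    Tendsto (fun a : ℝ => ∫ θ in (-Real.pi)..Real.pi, hankelKernel p (a + θ * I)) atBot
      (𝓝 (if p = 0 then 2 * Real.pi else 0)) := by
  have key : Tendsto (fun a : ℝ => ∫ θ in (-Real.pi)..Real.pi, hankelKernel p (a + θ * I)) atBot
      (𝓝 (∫ _ in (-Real.pi)..Real.pi, if p = 0 then (1 : ℂ) else 0)) := by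
    refine intervalIntegral.tendsto_integral_filter_of_dominated_convergence
      (fun _ => Real.exp 1) ?_ ?_ (by simp) ?_
    · have := (differentiable_hankelKernel p).continuous
      exact Eventually.of_forall fun a => Continuous.aestronglyMeasurable (by fun_prop)
    · filter_upwards [eventually_le_atBot 0] with a ha
      refine ae_of_all _ fun θ _ => ?_
      rw [norm_hankelKernel, ← Real.exp_add]
      have h1 : Real.exp a ≤ 1 := Real.exp_le_one_iff.2 ha
      gcongr
      nlinarith [Real.cos_le_one θ, Real.exp_pos a]
    · refine ae_of_all _ fun θ _ => ?_
      have h0 : Tendsto (fun a : ℝ => exp ((a : ℂ) + θ * I)) atBot (𝓝 0) := by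
        rw [tendsto_zero_iff_norm_tendsto_zero]
        simpa [norm_exp] using Real.tendsto_exp_atBot
      have h1 : Tendsto (fun a : ℝ => exp (exp ((a : ℂ) + θ * I))) atBot (𝓝 1) := by
        simpa [Function.comp_def] using (Complex.continuous_exp.tendsto 0).comp h0
      unfold hankelKernel
      split_ifs with hp0
      · simpa [hp0] using h1
      · have h2 : Tendsto (fun a : ℝ => exp (p * ((a : ℂ) + θ * I))) atBot (𝓝 0) := by
          rw [tendsto_zero_iff_norm_tendsto_zero]
          have : Tendsto (fun a : ℝ => p * a) atBot atBot :=
            tendsto_id.const_mul_atBot (lt_of_le_of_ne hp (Ne.symm hp0))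
          have h3 := Real.tendsto_exp_atBot.comp this
          simpa only [Function.comp_def, norm_exp, re_ofReal_mul, add_re, ofReal_re, mul_re, I_re,
            mul_zero, ofReal_im, I_im, zero_mul, sub_zero, add_zero] using h3
        simpa using h1.mul h2
  convert key using 2
  split_ifs
  · simp; ring
  · simp

/-- Hankel's formula for the reciprocal Gamma function at real `1 - p > 0`. -/
lemma hankelIntegral_pi_of_mem_Ico {p : ℝ} (h0 : 0 ≤ p) (h1 : p < 1) :
    hankelIntegral Real.pi 0 (hankelKernel p) = 2 * Real.pi * I / Real.Gamma (1 - p) := by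
  have hlim := (tendsto_integral_hankelKernel_atBot h0).const_mul I
  have hJ : Tendsto (fun a : ℝ => hankelIntegral Real.pi a (hankelKernel p)) atBot
      (𝓝 (hankelIntegral Real.pi 0 (hankelKernel p))) :=
    tendsto_const_nhds.congr fun a => (hankelIntegral_pi_hankelKernel_eq p a).symm
  rcases eq_or_lt_of_le h0 with rfl | hp
  · refine tendsto_nhds_unique hJ ?_
    simp only [hankelIntegral, hankelKernel_add_pi, hankelKernel_sub_pi, if_true] at hlim ⊢
    simpa [mul_comm] using hlim
  · have hint := integrable_exp_neg_exp_mul_exp hp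
    have hh := (aecover_Ioi (μ := (volume : Measure ℝ)) tendsto_id
      ).integral_tendsto_of_countably_generated hint
    rw [integral_exp_neg_exp_mul_exp hp] at hh
    have hh' := (continuous_ofReal.tendsto _).comp hh
    have lim := (hlim.add (hh'.mul_const (exp (p * Real.pi * I)))).sub
      (hh'.mul_const (exp (-(p * Real.pi * I))))
    have := tendsto_nhds_unique (hJ.congr fun a => ?_) lim
    · rw [this, if_neg hp.ne']
      have hrefl := Real.Gamma_mul_Gamma_one_sub p
      have hg : Real.Gamma (1 - p) ≠ 0 := (Real.Gamma_pos_of_pos (by linarith)).ne'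
      have hs : Real.sin (Real.pi * p) ≠ 0 :=
        (Real.sin_pos_of_pos_of_lt_pi (by positivity) (by nlinarith [Real.pi_pos])).ne'
      have hsin : exp (p * Real.pi * I) - exp (-(p * Real.pi * I)) =
          2 * I * (Real.sin (Real.pi * p) : ℝ) := by
        rw [ofReal_sin, Complex.sin, ofReal_mul, neg_mul, mul_comm (Real.pi : ℂ)]
        linear_combination (exp (p * Real.pi * I) - exp (-(p * Real.pi * I))) * I_mul_I
      rw [eq_div_iff hs] at hrefl
      have reflC := congrArg (fun x : ℝ => (x : ℂ)) hrefl
      push_cast at reflC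
      rw [eq_div_iff (ofReal_ne_zero.2 hg)]
      push_cast at hsin ⊢
      linear_combination (Real.Gamma p : ℂ) * Real.Gamma (1 - p) * hsin + 2 * I * reflC
    · simp only [hankelIntegral, hankelKernel_add_pi, hankelKernel_sub_pi, integral_mul_const,
        integral_complex_ofReal, Function.comp_apply, id]

lemma hankelIntegral_pi_hankelKernel {p : ℝ} (hp : p < 1) :
    hankelIntegral Real.pi 0 (hankelKernel p) = 2 * Real.pi * I / Real.Gamma (1 - p) := by
  obtain ⟨n, hn⟩ := exists_nat_ge (-p)
  induction n generalizing p with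
  | zero => exact hankelIntegral_pi_of_mem_Ico (by simpa using hn) hp
  | succ n ih =>
    rcases le_or_gt 0 p with h0 | h0
    · exact hankelIntegral_pi_of_mem_Ico h0 hp
    · have h := ih (p := p + 1) (by linarith) (by push_cast at hn; linarith)
      rw [hankelIntegral_hankelKernel_add_one] at h
      have hg : Real.Gamma (-p) ≠ 0 := (Real.Gamma_pos_of_pos (by linarith)).ne'
      have hr := Real.Gamma_add_one (s := -p) (by linarith)
      have hr' : Real.Gamma (1 - p) = -p * Real.Gamma (-p) := by rw [← hr]; ring_nf
      rw [show 1 - (p + 1) = -p by ring] at h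
      have hp0 : (p : ℂ) ≠ 0 := ofReal_ne_zero.2 h0.ne
      have hgc : (Real.Gamma (-p) : ℂ) ≠ 0 := ofReal_ne_zero.2 hg
      rw [hr']
      push_cast
      field_simp at h ⊢
      linear_combination -h

lemma hankelIntegral_hankelKernel {φ p : ℝ} (h0 : 0 ≤ φ) (hπ : φ ≤ Real.pi)
    (hφ : Real.cos φ < 0) (hp : p < 1) :
    hankelIntegral φ 0 (hankelKernel p) = 2 * Real.pi * I / Real.Gamma (1 - p) := by
  rw [hankelIntegral_hankelKernel_eq_pi h0 hπ hφ, hankelIntegral_pi_hankelKernel hp]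

lemma hankelIntegral_const_mul (φ a : ℝ) (c : ℂ) (F : ℂ → ℂ) :
    hankelIntegral φ a (fun w => c * F w) = c * hankelIntegral φ a F := by
  simp only [hankelIntegral, intervalIntegral.integral_const_mul, integral_const_mul]
  ring

lemma hankelIntegral_sub {φ a : ℝ} {F G : ℂ → ℂ}
    (hF : IntervalIntegrable (fun θ : ℝ => F (a + θ * I)) volume (-φ) φ)
    (hF₁ : IntegrableOn (fun ρ : ℝ => F (ρ + φ * I)) (Ioi a))
    (hF₂ : IntegrableOn (fun ρ : ℝ => F (ρ + (-φ : ℝ) * I)) (Ioi a))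
    (hG : IntervalIntegrable (fun θ : ℝ => G (a + θ * I)) volume (-φ) φ)
    (hG₁ : IntegrableOn (fun ρ : ℝ => G (ρ + φ * I)) (Ioi a))
    (hG₂ : IntegrableOn (fun ρ : ℝ => G (ρ + (-φ : ℝ) * I)) (Ioi a)) :
    hankelIntegral φ a (fun w => F w - G w) = hankelIntegral φ a F - hankelIntegral φ a G := by
  simp only [hankelIntegral]
  rw [intervalIntegral.integral_sub hF hG, integral_sub hF₁ hG₁, integral_sub hF₂ hG₂]
  ring

lemma norm_hankelIntegral_le {φ a C : ℝ} (hφ : 0 ≤ φ) {F G : ℂ → ℂ}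
    (hG : IntervalIntegrable (fun θ : ℝ => G (a + θ * I)) volume (-φ) φ)
    (hG₁ : IntegrableOn (fun ρ : ℝ => G (ρ + φ * I)) (Ioi a))
    (hG₂ : IntegrableOn (fun ρ : ℝ => G (ρ + (-φ : ℝ) * I)) (Ioi a))
    (h : ∀ w : ℂ, |w.im| ≤ φ → ‖F w‖ ≤ C * ‖G w‖) :
    ‖hankelIntegral φ a F‖ ≤ C * ((∫ θ in (-φ)..φ, ‖G (a + θ * I)‖) +
      (∫ ρ in Ioi a, ‖G (ρ + φ * I)‖) + ∫ ρ in Ioi a, ‖G (ρ + (-φ : ℝ) * I)‖) := by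
  have b0 : ‖∫ θ in (-φ)..φ, F (a + θ * I)‖ ≤ ∫ θ in (-φ)..φ, C * ‖G (a + θ * I)‖ := by
    refine intervalIntegral.norm_integral_le_of_norm_le (by linarith)
      (ae_of_all _ fun θ hθ => h _ ?_) (hG.norm.const_mul C)
    simpa [abs_le] using ⟨hθ.1.le, hθ.2⟩
  have b1 : ‖∫ ρ in Ioi a, F (ρ + φ * I)‖ ≤ ∫ ρ in Ioi a, C * ‖G (ρ + φ * I)‖ :=
    norm_integral_le_of_norm_le (hG₁.norm.const_mul C)
      (ae_of_all _ fun ρ => h _ (by simp [abs_of_nonneg hφ]))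
  have b2 : ‖∫ ρ in Ioi a, F (ρ + (-φ : ℝ) * I)‖ ≤
      ∫ ρ in Ioi a, C * ‖G (ρ + (-φ : ℝ) * I)‖ :=
    norm_integral_le_of_norm_le (hG₂.norm.const_mul C)
      (ae_of_all _ fun ρ => h _ (by simp [abs_of_nonneg hφ]))
  rw [intervalIntegral.integral_const_mul] at b0
  rw [integral_const_mul] at b1 b2
  unfold hankelIntegral
  refine (norm_sub_le _ _).trans ?_
  have h1 := norm_add_le (I * ∫ θ in (-φ)..φ, F (a + θ * I)) (∫ ρ in Ioi a, F (ρ + φ * I))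
  rw [norm_mul, norm_I, one_mul] at h1
  linarith

/-- The integrand of the Hankel-type representation of `mittagLeffler α 1 z`. -/
noncomputable def mittagLefflerKernel (α : ℝ) (z w : ℂ) : ℂ :=
  exp (exp w) * (1 - z * exp (-(α * w)))⁻¹

lemma hasSum_mittagLefflerKernel {α : ℝ} {z w : ℂ} (h : ‖z * exp (-(α * w))‖ < 1) :
    HasSum (fun k : ℕ => z ^ k * hankelKernel (-(k * α)) w) (mittagLefflerKernel α z w) := by
  refine ((hasSum_geometric_of_norm_lt_one h).mul_left (exp (exp w))).congr_fun fun k => ?_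
  rw [hankelKernel, mul_pow, ← Complex.exp_nat_mul]
  push_cast
  ring_nf

lemma norm_mul_exp_le_half {α a : ℝ} (hα : 0 ≤ α) {z : ℂ} (h : ‖z‖ * Real.exp (-(α * a)) ≤ 1 / 2)
    {x : ℝ} (hx : a ≤ x) (y : ℝ) : ‖z * exp (-(α * (x + y * I)))‖ ≤ 1 / 2 := by
  refine le_trans ?_ h
  rw [norm_mul, norm_exp]
  simp only [neg_re, add_re, ofReal_re, mul_re, I_re, mul_zero, ofReal_im, I_im,
    zero_mul, sub_zero, add_zero]
  gcongr

lemma norm_mul_hankelKernel_le {α a : ℝ} (hα : 0 ≤ α) {z : ℂ}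
    (h : ‖z‖ * Real.exp (-(α * a)) ≤ 1 / 2) {x : ℝ} (hx : a ≤ x) (y : ℝ) (k : ℕ) :
    ‖z ^ k * hankelKernel (-(k * α)) (x + y * I)‖ ≤
      Real.exp (Real.exp x * Real.cos y) * (1 / 2) ^ k := by
  have hq := pow_le_pow_left₀ (norm_nonneg _) (norm_mul_exp_le_half hα h hx y) k
  have e : z ^ k * hankelKernel (-(k * α)) (x + y * I) =
      exp (exp (x + y * I)) * (z * exp (-(α * (x + y * I)))) ^ k := by
    rw [hankelKernel, mul_pow, ← Complex.exp_nat_mul]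
    push_cast
    ring_nf
  have hn : ‖exp (exp ((x : ℂ) + y * I))‖ = Real.exp (Real.exp x * Real.cos y) := by
    simp [norm_exp, exp_re]
  rw [e, norm_mul, norm_pow, hn]
  gcongr

lemma hasSum_hankelIntegral {α φ a : ℝ} (hα : 0 ≤ α) (hφ : Real.cos φ < 0) {z : ℂ}
    (h : ‖z‖ * Real.exp (-(α * a)) ≤ 1 / 2) :
    HasSum (fun k : ℕ => z ^ k * hankelIntegral φ a (hankelKernel (-(k * α))))
      (hankelIntegral φ a (mittagLefflerKernel α z)) := by
  have hc : ∀ p, Continuous (hankelKernel p) := fun p => (differentiable_hankelKernel p).continuous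
  have hsum : ∀ x : ℝ, a ≤ x → ∀ y : ℝ, HasSum (fun k : ℕ => z ^ k *
      hankelKernel (-(k * α)) (x + y * I)) (mittagLefflerKernel α z (x + y * I)) := fun x hx y =>
    hasSum_mittagLefflerKernel ((norm_mul_exp_le_half hα h hx y).trans_lt (by norm_num))
  have hgeo : Summable fun k : ℕ => (1 / 2 : ℝ) ^ k := summable_geometric_two
  have hhor : ∀ y : ℝ, Real.cos y < 0 → HasSum (fun k : ℕ => ∫ ρ in Ioi a,
      z ^ k * hankelKernel (-(k * α)) (ρ + y * I))
      (∫ ρ in Ioi a, mittagLefflerKernel α z (ρ + y * I)) := by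
    intro y hy
    refine hasSum_integral_of_dominated_convergence
      (fun k ρ => Real.exp (Real.exp ρ * Real.cos y) * (1 / 2) ^ k) (fun k => ?_) (fun k => ?_)
      (ae_of_all _ fun ρ => hgeo.mul_left _) ?_ ?_
    · have := hc (-(k * α))
      exact Continuous.aestronglyMeasurable (by fun_prop)
    · exact (ae_restrict_mem measurableSet_Ioi).mono fun ρ hρ =>
        norm_mul_hankelKernel_le hα h (le_of_lt hρ) y k
    · simp only [tsum_mul_left]
      simpa [IntegrableOn] using (integrableOn_exp_exp_mul_exp hy 0 a).mul_const
        (∑' k : ℕ, (1 / 2 : ℝ) ^ k)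
    · exact (ae_restrict_mem measurableSet_Ioi).mono fun ρ hρ => hsum ρ (le_of_lt hρ) y
  have hver : HasSum (fun k : ℕ => ∫ θ in (-φ)..φ, z ^ k * hankelKernel (-(k * α)) (a + θ * I))
      (∫ θ in (-φ)..φ, mittagLefflerKernel α z (a + θ * I)) := by
    refine intervalIntegral.hasSum_integral_of_dominated_convergence
      (fun k θ => Real.exp (Real.exp a * Real.cos θ) * (1 / 2) ^ k) (fun k => ?_)
      (fun k => ae_of_all _ fun θ _ => norm_mul_hankelKernel_le hα h le_rfl θ k)
      (ae_of_all _ fun ρ _ => hgeo.mul_left _) ?_ (ae_of_all _ fun θ _ => hsum a le_rfl θ)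
    · have := hc (-(k * α))
      exact Continuous.aestronglyMeasurable (by fun_prop)
    · simp only [tsum_mul_left]
      exact Continuous.intervalIntegrable (by fun_prop) _ _
  refine (((hver.mul_left I).add (hhor φ hφ)).sub (hhor (-φ) (by rwa [Real.cos_neg]))).congr_fun
    fun k => ?_
  rw [← hankelIntegral_const_mul, hankelIntegral]

/-- The Mittag–Leffler series, summed along a Hankel-type contour far enough to the right. -/
lemma hasSum_mittagLeffler {α φ a : ℝ} (hα : 0 ≤ α) (h0 : 0 ≤ φ) (hπ : φ ≤ Real.pi)
    (hφ : Real.cos φ < 0) {z : ℂ} (h : ‖z‖ * Real.exp (-(α * a)) ≤ 1 / 2) :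
    HasSum (fun k : ℕ => z ^ k / (Real.Gamma (k * α + 1) : ℂ))
      ((2 * Real.pi * I)⁻¹ * hankelIntegral φ a (mittagLefflerKernel α z)) := by
  have hφ' : Real.cos (-φ) < 0 := by rwa [Real.cos_neg]
  refine ((hasSum_hankelIntegral hα hφ h).mul_left _).congr_fun fun k => ?_
  rw [hankelIntegral_eq_of_differentiableOn (b := 0) h0
    (differentiable_hankelKernel _).differentiableOn (integrableOn_hankelKernel hφ _ a)
    (integrableOn_hankelKernel hφ' _ a) (integrableOn_hankelKernel hφ _ 0)
    (integrableOn_hankelKernel hφ' _ 0),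
    hankelIntegral_hankelKernel h0 hπ hφ (by have : 0 ≤ k * α := by positivity
                                             linarith),
    show 1 - -((k : ℝ) * α) = k * α + 1 by ring]
  have := two_pi_I_ne_zero
  field_simp

lemma exists_mul_exp_le_half {α : ℝ} (hα : 0 < α) (z : ℂ) :
    ∃ a : ℝ, ‖z‖ * Real.exp (-(α * a)) ≤ 1 / 2 := by
  have : Tendsto (fun a : ℝ => ‖z‖ * Real.exp (-(α * a))) atTop (𝓝 (‖z‖ * 0)) :=
    (Real.tendsto_exp_neg_atTop_nhds_zero.comp (tendsto_id.const_mul_atTop hα)).const_mul _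
  rw [mul_zero] at this
  exact (this.eventually_le_const (by norm_num)).exists

lemma continuous_mittagLeffler {α : ℝ} (hα : 0 < α) : Continuous (mittagLeffler α 1) := by
  have hs : ∀ z : ℂ, Summable fun k : ℕ => z ^ k / (Real.Gamma (k * α + 1) : ℂ) := fun z => by
    obtain ⟨a, ha⟩ := exists_mul_exp_le_half hα z
    exact (hasSum_mittagLeffler hα.le Real.pi_pos.le le_rfl (by simp) ha).summable
  rw [continuous_iff_continuousAt]
  intro z
  have hc : ContinuousOn (mittagLeffler α 1) (Metric.ball 0 (‖z‖ + 1)) := by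
    refine continuousOn_tsum (fun k => by fun_prop) (hs ((‖z‖ + 1 : ℝ) : ℂ)).norm fun k w hw => ?_
    rw [norm_div, norm_div, norm_pow, norm_pow, norm_real (‖z‖ + 1),
      Real.norm_of_nonneg (by positivity)]
    gcongr
    exact (mem_ball_zero_iff.1 hw).le
  exact hc.continuousAt (Metric.isOpen_ball.mem_nhds (by simp))

section Asymptotics

variable {α φ c : ℝ} {z : ℂ}

lemma mittagLefflerKernel_eq (hz : z ≠ 0) (w : ℂ) :
    mittagLefflerKernel α z w = -z⁻¹ * hankelKernel α w * (1 - z⁻¹ * exp (α * w))⁻¹ := by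
  have e : 1 - z * exp (-(α * w)) = -(z * exp (-(α * w))) * (1 - z⁻¹ * exp (α * w)) := by
    have : exp (-(α * w)) * exp (α * w) = 1 := by rw [← Complex.exp_add]; simp
    field_simp
    linear_combination -this
  rw [mittagLefflerKernel, e, hankelKernel, mul_inv, Complex.exp_neg]
  have := Complex.exp_ne_zero (α * w)
  field_simp

lemma mittagLefflerKernel_sub (hz : z ≠ 0) {w : ℂ} (h : 1 - z⁻¹ * exp (α * w) ≠ 0) :
    mittagLefflerKernel α z w - -z⁻¹ * hankelKernel α w =
      -z⁻¹ ^ 2 * (1 - z⁻¹ * exp (α * w))⁻¹ * hankelKernel (2 * α) w := by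
  have e : hankelKernel (2 * α) w = hankelKernel α w * exp (α * w) := by
    rw [hankelKernel, hankelKernel, show ((2 * α : ℝ) : ℂ) * w = α * w + α * w by push_cast; ring,
      Complex.exp_add, mul_assoc]
  rw [mittagLefflerKernel_eq hz, e]
  have := mul_inv_cancel₀ h
  linear_combination -z⁻¹ * hankelKernel α w * this

lemma one_sub_ne_zero_of_le_norm (hc : 0 < c)
    (h : ∀ w : ℂ, |w.im| ≤ φ → c ≤ ‖1 - z⁻¹ * exp (α * w)‖) {w : ℂ} (hw : |w.im| ≤ φ) :
    1 - z⁻¹ * exp (α * w) ≠ 0 := norm_pos_iff.1 (hc.trans_le (h w hw))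

lemma one_sub_mul_exp_neg_ne_zero (hz : z ≠ 0) {w : ℂ} (h : 1 - z⁻¹ * exp (α * w) ≠ 0) :
    1 - z * exp (-(α * w)) ≠ 0 := by
  intro h'
  apply h
  have h1 : z * exp (-(α * w)) = 1 := (sub_eq_zero.1 h').symm
  rw [Complex.exp_neg] at h1
  rw [sub_eq_zero]
  have := Complex.exp_ne_zero (α * w)
  field_simp at h1 ⊢
  exact h1

lemma differentiableAt_mittagLefflerKernel {w : ℂ} (h : 1 - z * exp (-(α * w)) ≠ 0) :
    DifferentiableAt ℂ (mittagLefflerKernel α z) w := by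
  unfold mittagLefflerKernel
  have : DifferentiableAt ℂ (fun w : ℂ => (1 - z * exp (-(α * w)))⁻¹) w :=
    DifferentiableAt.inv (by fun_prop) h
  fun_prop

lemma integrableOn_mittagLefflerKernel (hz : z ≠ 0) (hc : 0 < c)
    (h : ∀ w : ℂ, |w.im| ≤ φ → c ≤ ‖1 - z⁻¹ * exp (α * w)‖) {y : ℝ} (hy : |y| ≤ φ)
    (hcos : Real.cos y < 0) (a : ℝ) :
    IntegrableOn (fun ρ : ℝ => mittagLefflerKernel α z (ρ + y * I)) (Ioi a) := by
  have hne : ∀ ρ : ℝ, 1 - z⁻¹ * exp (α * ((ρ : ℂ) + y * I)) ≠ 0 := fun ρ =>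
    one_sub_ne_zero_of_le_norm hc h (by simpa using hy)
  refine (((integrableOn_hankelKernel hcos α a).norm).const_mul (‖z‖⁻¹ * c⁻¹)).mono' ?_
    (ae_of_all _ fun ρ => ?_)
  · refine Continuous.aestronglyMeasurable (continuous_iff_continuousAt.2 fun ρ => ?_)
    exact ContinuousAt.comp (f := fun ρ : ℝ => (ρ : ℂ) + y * I) (x := ρ)
      (differentiableAt_mittagLefflerKernel (one_sub_mul_exp_neg_ne_zero hz (hne ρ))).continuousAt
      (by fun_prop)
  · rw [mittagLefflerKernel_eq hz, norm_mul, norm_mul, norm_neg, norm_inv, norm_inv,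
      mul_right_comm]
    gcongr
    exact h _ (by simpa using hy)

lemma norm_mittagLeffler_add_le (hα : 0 < α) (hα1 : α < 1) (h0 : 0 ≤ φ) (hπ : φ ≤ Real.pi)
    (hφ : Real.cos φ < 0) (hc : 0 < c) :
    ∃ K : ℝ, ∀ z : ℂ, z ≠ 0 → (∀ w : ℂ, |w.im| ≤ φ → c ≤ ‖1 - z⁻¹ * exp (α * w)‖) →
      ‖mittagLeffler α 1 z + z⁻¹ / Real.Gamma (1 - α)‖ ≤ K * ‖z‖⁻¹ ^ 2 := by
  have hφ' : Real.cos (-φ) < 0 := by rwa [Real.cos_neg]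
  have hK : ∀ p u v, IntervalIntegrable (fun θ : ℝ => hankelKernel p ((0 : ℝ) + θ * I))
      volume u v := fun p u v => by
    have := (differentiable_hankelKernel p).continuous
    exact Continuous.intervalIntegrable (by fun_prop) _ _
  refine ⟨(2 * Real.pi)⁻¹ * (c⁻¹ * ((∫ θ in (-φ)..φ, ‖hankelKernel (2 * α) ((0 : ℝ) + θ * I)‖) +
      (∫ ρ in Ioi (0 : ℝ), ‖hankelKernel (2 * α) (ρ + φ * I)‖) +
      ∫ ρ in Ioi (0 : ℝ), ‖hankelKernel (2 * α) (ρ + (-φ : ℝ) * I)‖)), fun z hz h => ?_⟩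
  have hne : ∀ w : ℂ, |w.im| ≤ φ → 1 - z⁻¹ * exp (α * w) ≠ 0 := fun w hw =>
    one_sub_ne_zero_of_le_norm hc h hw
  have hd : ∀ w : ℂ, |w.im| ≤ φ → DifferentiableAt ℂ (mittagLefflerKernel α z) w := fun w hw =>
    differentiableAt_mittagLefflerKernel (one_sub_mul_exp_neg_ne_zero hz (hne w hw))
  obtain ⟨a, ha⟩ := exists_mul_exp_le_half hα z
  have hi := integrableOn_mittagLefflerKernel hz hc h (y := φ) (by rw [abs_of_nonneg h0]) hφ
  have hi' := integrableOn_mittagLefflerKernel hz hc h (y := -φ)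
    (by rw [abs_neg, abs_of_nonneg h0]) hφ'
  have hE : mittagLeffler α 1 z =
      (2 * Real.pi * I)⁻¹ * hankelIntegral φ 0 (mittagLefflerKernel α z) := by
    rw [← hankelIntegral_eq_of_differentiableOn h0 (fun w hw => (hd w ?_).differentiableWithinAt)
      (hi a) (hi' a) (hi 0) (hi' 0)]
    · exact (hasSum_mittagLeffler hα.le h0 hπ hφ ha).tsum_eq
    · exact abs_le.2 (mem_reProdIm.1 hw).2
  have hv : IntervalIntegrable (fun θ : ℝ => mittagLefflerKernel α z ((0 : ℝ) + θ * I))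
      volume (-φ) φ := by
    refine ContinuousOn.intervalIntegrable fun θ hθ => ContinuousAt.continuousWithinAt ?_
    rw [uIcc_of_le (by linarith)] at hθ
    exact ContinuousAt.comp (f := fun θ : ℝ => ((0 : ℝ) : ℂ) + θ * I) (x := θ)
      (hd _ (by simpa [abs_le] using hθ)).continuousAt (by fun_prop)
  have hsub := hankelIntegral_sub hv (hi 0) (hi' 0)
    (G := fun w => -z⁻¹ * hankelKernel α w) ((hK α _ _).const_mul _)
    ((integrableOn_hankelKernel hφ α 0).const_mul _)
    ((integrableOn_hankelKernel hφ' α 0).const_mul _)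
  rw [hankelIntegral_const_mul, hankelIntegral_hankelKernel h0 hπ hφ hα1] at hsub
  have hb := norm_hankelIntegral_le (C := ‖z‖⁻¹ ^ 2 * c⁻¹) h0 (hK (2 * α) (-φ) φ)
    (integrableOn_hankelKernel hφ (2 * α) 0) (integrableOn_hankelKernel hφ' (2 * α) 0)
    (F := fun w => mittagLefflerKernel α z w - -z⁻¹ * hankelKernel α w) (fun w hw => by
      rw [mittagLefflerKernel_sub hz (hne w hw), norm_mul, norm_mul, norm_neg, norm_pow, norm_inv,
        norm_inv]
      gcongr
      exact h w hw)
  have hfin : mittagLeffler α 1 z + z⁻¹ / Real.Gamma (1 - α) = (2 * Real.pi * I)⁻¹ *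
      hankelIntegral φ 0 (fun w => mittagLefflerKernel α z w - -z⁻¹ * hankelKernel α w) := by
    rw [hE, hsub]
    have := two_pi_I_ne_zero
    field_simp
    ring
  have hn : ‖(2 * Real.pi * I : ℂ)⁻¹‖ = (2 * Real.pi)⁻¹ := by
    simp [abs_of_pos Real.pi_pos]
  rw [hfin, norm_mul, hn]
  calc _ ≤ _ := mul_le_mul_of_nonneg_left hb (by positivity)
    _ = _ := by ring

end Asymptotics

lemma cos_le_norm_one_sub {α φ : ℝ} (hα : 0 ≤ α) (hφ : α * φ ≤ Real.pi / 2) (y : ℝ)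
    {w : ℂ} (hw : |w.im| ≤ φ) :
    Real.cos (α * φ) ≤ ‖1 - (I * y)⁻¹ * exp (α * w)‖ := by
  have hθ : |α * w.im| ≤ α * φ := by
    rw [abs_mul, abs_of_nonneg hα]
    gcongr
  have hc : Real.cos (α * φ) ≤ Real.cos (α * w.im) := by
    rw [← Real.cos_abs (α * w.im)]
    exact Real.cos_le_cos_of_nonneg_of_le_pi (abs_nonneg _) (by linarith [Real.pi_pos]) hθ
  have hc0 : 0 ≤ Real.cos (α * φ) :=
    Real.cos_nonneg_of_neg_pi_div_two_le_of_le
      (by linarith [abs_nonneg (α * w.im), Real.pi_pos]) hφ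
  refine hc.trans ?_
  set x : ℝ := y⁻¹ * Real.exp (α * w.re) with hx
  set θ := α * w.im with hθdef
  have hz : 1 - (I * y)⁻¹ * exp (α * w) =
      ((1 - x * Real.sin θ : ℝ) : ℂ) + ((x * Real.cos θ : ℝ) : ℂ) * I := by
    have hexp : exp (α * w) = Real.exp (α * w.re) * (Real.cos θ + Real.sin θ * I) := by
      rw [ofReal_exp, ofReal_cos, ofReal_sin, ← Complex.exp_mul_I, ← Complex.exp_add]
      congr 1
      rw [hθdef]
      push_cast
      conv_lhs => rw [← re_add_im w]
      ring
    rw [hexp, mul_inv, inv_I, hx]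
    push_cast
    linear_combination (y : ℂ)⁻¹ * exp (α * w.re) * sin θ * I_mul_I
  rw [hz, norm_add_mul_I]
  refine Real.le_sqrt_of_sq_le ?_
  nlinarith [sq_nonneg (x - Real.sin θ), Real.sin_sq_add_cos_sq θ, sq_nonneg (x * Real.sin θ)]

/-- Leading-order decay of the Mittag–Leffler function along the positive imaginary axis. -/
lemma exists_norm_mittagLeffler_I_mul_le {α : ℝ} (h0 : 0 < α) (h1 : α < 1) :
    ∃ K : ℝ, ∀ y : ℝ, 0 < y →
      ‖mittagLeffler α 1 (I * y) - I / Real.Gamma (1 - α) * (y : ℂ)⁻¹‖ ≤ K * y⁻¹ ^ 2 := by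
  have hπ := Real.pi_pos
  have hlo : Real.pi / 2 < Real.pi / (1 + α) := by gcongr; linarith
  have hhi : Real.pi / (1 + α) ≤ Real.pi := div_le_self hπ.le (by linarith)
  have hα : α * (Real.pi / (1 + α)) < Real.pi / 2 := by
    have : α * (Real.pi / (1 + α)) = Real.pi - Real.pi / (1 + α) := by field_simp; ring
    linarith
  have hα0 : 0 ≤ α * (Real.pi / (1 + α)) := by positivity
  obtain ⟨K, hK⟩ := norm_mittagLeffler_add_le h0 h1 (by positivity) hhi
    (Real.cos_neg_of_pi_div_two_lt_of_lt hlo (by linarith))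
    (Real.cos_pos_of_mem_Ioo ⟨by linarith, hα⟩)
  refine ⟨K, fun y hy => ?_⟩
  have := hK (I * y) (mul_ne_zero I_ne_zero (ofReal_ne_zero.2 hy.ne'))
    fun w hw => cos_le_norm_one_sub h0.le hα.le y hw
  rw [norm_mul, norm_I, one_mul, norm_real, Real.norm_of_nonneg hy.le] at this
  convert this using 2
  rw [mul_inv, inv_I]
  ring

lemma one_sub_two_mul_rpow_add_rpow_neg {p : ℝ} (h0 : 0 < p) (h1 : p < 1) :
    1 - 2 * (2 / 3 : ℝ) ^ p + (1 / 3 : ℝ) ^ p < 0 := by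
  have h := (Real.strictConcaveOn_rpow h0 h1).2 (show (1 : ℝ) ∈ Ici 0 by simp)
    (show (1 / 3 : ℝ) ∈ Ici 0 by simp) (by norm_num) (show (0 : ℝ) < 1 / 2 by norm_num)
    (show (0 : ℝ) < 1 / 2 by norm_num) (by norm_num)
  simp only [smul_eq_mul, Real.one_rpow] at h
  rw [show (1 / 2 * 1 + 1 / 2 * (1 / 3) : ℝ) = 2 / 3 by norm_num] at h
  linarith

lemma integral_rpow_sub_integral_rpow {α t : ℝ} (h1 : α < 1) (ht : 0 < t) :
    (∫ s in (2 * t / 3)..t, s ^ (-α)) - ∫ s in (t / 3)..(2 * t / 3), s ^ (-α) =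
      (1 - 2 * (2 / 3 : ℝ) ^ (1 - α) + (1 / 3 : ℝ) ^ (1 - α)) / (1 - α) * t ^ (1 - α) := by
  rw [integral_rpow (Or.inl (by linarith)), integral_rpow (Or.inl (by linarith)),
    show -α + 1 = 1 - α by ring, show 2 * t / 3 = 2 / 3 * t by ring,
    show t / 3 = 1 / 3 * t by ring, Real.mul_rpow (by norm_num) ht.le,
    Real.mul_rpow (by norm_num) ht.le]
  ring

/-- The asymptotics of the difference of integrals of a function with leading term `D s ^ (-α)`. -/
lemma norm_integral_sub_integral_le {α K t : ℝ} (h0 : 0 < α) (h1 : α < 1) (ht : 0 < t) {D : ℂ}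
    {f : ℝ → ℂ} (hf : ContinuousOn f (Ioi 0))
    (h : ∀ s, 0 < s → ‖f s - D * ((s ^ (-α) : ℝ) : ℂ)‖ ≤ K * s ^ (-(2 * α))) :
    ‖(∫ s in (2 * t / 3)..t, f s) - (∫ s in (t / 3)..(2 * t / 3), f s) -
      D * (((1 - 2 * (2 / 3 : ℝ) ^ (1 - α) + (1 / 3 : ℝ) ^ (1 - α)) / (1 - α) * t ^ (1 - α) : ℝ) :
        ℂ)‖ ≤ K * (1 / 3 : ℝ) ^ (-(2 * α)) * t ^ (1 - 2 * α) := by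
  have hK : 0 ≤ K := by simpa using (norm_nonneg _).trans (h 1 one_pos)
  have hg : ContinuousOn (fun s : ℝ => D * ((s ^ (-α) : ℝ) : ℂ)) (Ioi 0) := by
    refine continuousOn_const.mul (continuous_ofReal.comp_continuousOn ?_)
    exact continuousOn_id.rpow_const fun s hs => Or.inl (ne_of_gt hs)
  have hi : ∀ {F : ℝ → ℂ} {u v : ℝ}, ContinuousOn F (Ioi 0) → 0 < u → u ≤ v →
      IntervalIntegrable F volume u v := fun hF hu huv =>
    (hF.mono fun s hs => by
      rw [uIcc_of_le huv] at hs
      exact hu.trans_le hs.1).intervalIntegrable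
  have hb : ∀ u v : ℝ, t / 3 ≤ u → u ≤ v → v ≤ t →
      ‖(∫ s in u..v, f s) - D * ((∫ s in u..v, s ^ (-α) : ℝ) : ℂ)‖ ≤
        K * ((1 / 3 : ℝ) ^ (-(2 * α)) * t ^ (-(2 * α))) * (v - u) := by
    intro u v hu huv hv
    have hu0 : 0 < u := by linarith
    rw [← intervalIntegral.integral_ofReal, ← intervalIntegral.integral_const_mul,
      ← intervalIntegral.integral_sub (hi hf hu0 huv) (hi hg hu0 huv),
      ← abs_of_nonneg (sub_nonneg.2 huv)]
    refine intervalIntegral.norm_integral_le_of_norm_le_const fun s hs => ?_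
    rw [uIoc_of_le huv] at hs
    refine (h s (hu0.trans hs.1)).trans ?_
    rw [← Real.mul_rpow (by norm_num) ht.le]
    refine mul_le_mul_of_nonneg_left ?_ hK
    exact Real.rpow_le_rpow_of_nonpos (by positivity) (by linarith [hs.1]) (by linarith)
  have b1 := hb (2 * t / 3) t (by linarith) (by linarith) le_rfl
  have b2 := hb (t / 3) (2 * t / 3) le_rfl (by linarith) (by linarith)
  have hpow : t ^ (1 - 2 * α) = t ^ (-(2 * α)) * t := by
    rw [show 1 - 2 * α = -(2 * α) + 1 by ring, Real.rpow_add ht, Real.rpow_one]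
  rw [← integral_rpow_sub_integral_rpow h1 ht, hpow]
  have e : ∀ A B P Q : ℂ, A - B - D * (P - Q) = (A - D * P) - (B - D * Q) := fun A B P Q => by ring
  rw [ofReal_sub, e]
  refine (norm_sub_le _ _).trans ((add_le_add b1 b2).trans ?_)
  have : 0 ≤ K * ((1 / 3 : ℝ) ^ (-(2 * α)) * t ^ (-(2 * α))) * t := by positivity
  linarith

lemma exists_integral_mittagLeffler_asymptotics {α : ℝ} (h0 : 0 < α) (h1 : α < 1) :
    ∃ Cα : ℂ, Cα ≠ 0 ∧
      ∀ lam : ℝ, 0 < lam → ∃ C' > 0, ∃ T > 0, ∀ t : ℝ, T ≤ t →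
        ‖((∫ τ in (0:ℝ)..(t / 3),
              mittagLeffler α 1 (I * (lam : ℂ) * (((t - τ) ^ α : ℝ) : ℂ))) -
            ∫ τ in (t / 3)..(2 * t / 3),
              mittagLeffler α 1 (I * (lam : ℂ) * (((t - τ) ^ α : ℝ) : ℂ))) -
          Cα * (lam : ℂ)⁻¹ * ((t ^ (1 - α) : ℝ) : ℂ)‖ ≤ C' * t ^ (1 - 2 * α) := by
  obtain ⟨K, hK⟩ := exists_norm_mittagLeffler_I_mul_le h0 h1
  set κ : ℝ := (1 - 2 * (2 / 3 : ℝ) ^ (1 - α) + (1 / 3 : ℝ) ^ (1 - α)) / (1 - α) with hκ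
  have hκ0 : κ ≠ 0 :=
    div_ne_zero (one_sub_two_mul_rpow_add_rpow_neg (by linarith) (by linarith)).ne (by linarith)
  have hΓ : Real.Gamma (1 - α) ≠ 0 := (Real.Gamma_pos_of_pos (by linarith)).ne'
  refine ⟨I / Real.Gamma (1 - α) * κ, mul_ne_zero (div_ne_zero I_ne_zero (ofReal_ne_zero.2 hΓ))
    (ofReal_ne_zero.2 hκ0), fun lam hlam => ?_⟩
  set f : ℝ → ℂ := fun s => mittagLeffler α 1 (I * (lam : ℂ) * ((s ^ α : ℝ) : ℂ)) with hf
  have hfc : ContinuousOn f (Ioi 0) := by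
    refine (continuous_mittagLeffler h0).comp_continuousOn
      (continuousOn_const.mul (continuous_ofReal.comp_continuousOn ?_))
    exact continuousOn_id.rpow_const fun s hs => Or.inl (ne_of_gt hs)
  have hfb : ∀ s, 0 < s → ‖f s - I / Real.Gamma (1 - α) * (lam : ℂ)⁻¹ * ((s ^ (-α) : ℝ) : ℂ)‖ ≤
      K * lam⁻¹ ^ 2 * s ^ (-(2 * α)) := by
    intro s hs
    have := hK (lam * s ^ α) (by positivity)
    have e : s ^ (-(2 * α)) = (s ^ α)⁻¹ ^ 2 := by
      rw [← Real.rpow_neg hs.le, ← Real.rpow_natCast, ← Real.rpow_mul hs.le]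
      congr 1
      push_cast
      ring
    rw [e, Real.rpow_neg hs.le]
    convert this using 1
    · rw [hf]
      push_cast
      rw [mul_inv]
      ring_nf
    · rw [mul_inv]
      ring
  refine ⟨K * lam⁻¹ ^ 2 * (1 / 3 : ℝ) ^ (-(2 * α)) + 1, ?_, 1, one_pos, fun t ht => ?_⟩
  · have : 0 ≤ K := by simpa using (norm_nonneg _).trans (hK 1 one_pos)
    positivity
  · have ht0 : 0 < t := by linarith
    have key := norm_integral_sub_integral_le h0 h1 ht0 hfc hfb
    have s1 := intervalIntegral.integral_comp_sub_left (a := 0) (b := t / 3) f t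
    have s2 := intervalIntegral.integral_comp_sub_left (a := t / 3) (b := 2 * t / 3) f t
    rw [sub_zero, show t - t / 3 = 2 * t / 3 by ring] at s1
    rw [show t - t / 3 = 2 * t / 3 by ring, show t - 2 * t / 3 = t / 3 by ring] at s2
    rw [← s1, ← s2, ← hκ] at key
    have hc : I / Real.Gamma (1 - α) * (lam : ℂ)⁻¹ * ((κ * t ^ (1 - α) : ℝ) : ℂ) =
        I / Real.Gamma (1 - α) * κ * (lam : ℂ)⁻¹ * ((t ^ (1 - α) : ℝ) : ℂ) := by
      rw [ofReal_mul]
      ring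
    rw [hc] at key
    refine key.trans ?_
    have : 0 < t ^ (1 - 2 * α) := by positivity
    linarith

end

/-- For `0 < α < 1` there is a nonzero constant `C_α ∈ ℂ` depending only on `α` such that
for every `λ > 0`,
`I_λ(t) = ∫_0^{t/3} E_{α,1}(iλ(t-τ)^α) dτ - ∫_{t/3}^{2t/3} E_{α,1}(iλ(t-τ)^α) dτ`
satisfies `I_λ(t) = C_α λ⁻¹ t^{1-α} + O(t^{1-2α})` as `t → ∞`. -/
theorem mittagLeffler_source_asymptotics (α : ℝ) (h0 : 0 < α) (h1 : α < 1) :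
    ∃ Cα : ℂ, Cα ≠ 0 ∧
      ∀ lam : ℝ, 0 < lam → ∃ C' > 0, ∃ T > 0, ∀ t : ℝ, T ≤ t →
        ‖((∫ τ in (0:ℝ)..(t / 3),
              mittagLeffler α 1 (Complex.I * (lam : ℂ) * (((t - τ) ^ α : ℝ) : ℂ))) -
            ∫ τ in (t / 3)..(2 * t / 3),
              mittagLeffler α 1 (Complex.I * (lam : ℂ) * (((t - τ) ^ α : ℝ) : ℂ))) -
          Cα * (lam : ℂ)⁻¹ * ((t ^ (1 - α) : ℝ) : ℂ)‖ ≤ C' * t ^ (1 - 2 * α) := by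
  exact exists_integral_mittagLeffler_asymptotics h0 h1
end

section
/- Let V be a normed complex vector space, let v, ṽ ∈ V be nonzero, and let α, α̃ ∈ (0, 1). Suppose w : (0, ∞) → V satisfies both ‖w(t) − t^{1−α} v‖ = O(t^{1−2α}) and ‖w(t) − t^{1−α̃} ṽ‖ = O(t^{1−2α̃}) as t → ∞ (i.e., each difference is bounded by a constant multiple of the indicated power for all sufficiently large t). Then α = α̃ and v = ṽ. -/
open Filter Topology

/-- A leading-order asymptotic with a remainder of strictly lower order gives convergence of the
rescaled function to the leading coefficient. -/
lemma tendsto_rpow_neg_smul {V : Type*} [NormedAddCommGroup V] [NormedSpace ℝ V]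
    {v : V} {a b C T : ℝ} (hba : b < a) {w : ℝ → V}
    (hw : ∀ t : ℝ, T ≤ t → ‖w t - t ^ a • v‖ ≤ C * t ^ b) :
    Tendsto (fun t : ℝ => t ^ (-a) • w t) atTop (𝓝 v) := by
  rw [tendsto_iff_norm_sub_tendsto_zero]
  have hlim : Tendsto (fun t : ℝ => C * t ^ (-(a - b))) atTop (𝓝 0) := by
    simpa using (tendsto_rpow_neg_atTop (sub_pos.2 hba)).const_mul C
  refine squeeze_zero' (Eventually.of_forall fun _ => norm_nonneg _) ?_ hlim
  filter_upwards [eventually_ge_atTop T, eventually_gt_atTop 0] with t hT ht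
  have hone : t ^ (-a) * t ^ a = 1 := by rw [← Real.rpow_add ht]; simp
  have hfactor : t ^ (-a) • w t - v = t ^ (-a) • (w t - t ^ a • v) := by
    rw [smul_sub, smul_smul, hone, one_smul]
  have hpos : 0 < t ^ (-a) := Real.rpow_pos_of_pos ht _
  calc ‖t ^ (-a) • w t - v‖ = t ^ (-a) * ‖w t - t ^ a • v‖ := by
        rw [hfactor, norm_smul, Real.norm_of_nonneg hpos.le]
    _ ≤ t ^ (-a) * (C * t ^ b) := mul_le_mul_of_nonneg_left (hw t hT) hpos.le
    _ = C * t ^ (-(a - b)) := by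
        rw [mul_left_comm, ← Real.rpow_add ht]
        ring_nf

/-- The growth exponent of a function with a nonzero rescaled limit is an upper bound for any
other such exponent. -/
lemma le_of_tendsto_rpow_neg_smul {V : Type*} [NormedAddCommGroup V] [NormedSpace ℝ V]
    {v v' : V} (hv' : v' ≠ 0) {a b : ℝ} {w : ℝ → V}
    (ha : Tendsto (fun t : ℝ => t ^ (-a) • w t) atTop (𝓝 v))
    (hb : Tendsto (fun t : ℝ => t ^ (-b) • w t) atTop (𝓝 v')) : b ≤ a := by
  by_contra! hab
  refine hv' (tendsto_nhds_unique hb ?_)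
  have hlim := (tendsto_rpow_neg_atTop (sub_pos.2 hab)).smul ha
  rw [zero_smul] at hlim
  refine hlim.congr' ?_
  filter_upwards [eventually_gt_atTop 0] with t ht
  rw [smul_smul, ← Real.rpow_add ht]
  ring_nf

/-- Abstract determination of the time-fractional order: if `w : (0,∞) → V` satisfies both
`‖w(t) - t^{1-α} v‖ = O(t^{1-2α})` and `‖w(t) - t^{1-α̃} ṽ‖ = O(t^{1-2α̃})` as `t → ∞`,
with `v, ṽ ≠ 0` and `α, α̃ ∈ (0,1)`, then `α = α̃` and `v = ṽ`. -/
theorem asymptotics_determine_order {V : Type*} [NormedAddCommGroup V] [NormedSpace ℂ V]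
    (v v' : V) (hv : v ≠ 0) (hv' : v' ≠ 0) (α α' : ℝ)
    (hα0 : 0 < α) (hα1 : α < 1) (hα0' : 0 < α') (hα1' : α' < 1)
    (w : ℝ → V)
    (hw : ∃ C T : ℝ, 0 < C ∧ ∀ t : ℝ, T ≤ t →
      ‖w t - (t ^ (1 - α) : ℝ) • v‖ ≤ C * t ^ (1 - 2 * α))
    (hw' : ∃ C T : ℝ, 0 < C ∧ ∀ t : ℝ, T ≤ t →
      ‖w t - (t ^ (1 - α') : ℝ) • v'‖ ≤ C * t ^ (1 - 2 * α')) :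
    α = α' ∧ v = v' := by
  obtain ⟨C, T, -, hw⟩ := hw
  obtain ⟨C', T', -, hw'⟩ := hw'
  have hlim := tendsto_rpow_neg_smul (by linarith) hw
  have hlim' := tendsto_rpow_neg_smul (by linarith) hw'
  have hle := le_of_tendsto_rpow_neg_smul hv' hlim hlim'
  have hge := le_of_tendsto_rpow_neg_smul hv hlim' hlim
  obtain rfl : α = α' := by linarith
  exact ⟨rfl, tendsto_nhds_unique hlim hlim'⟩
end
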